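/- The Fourier coefficients of the Jacobi–Eisenstein series E_{4,1} and E_{6,1} are congruent modulo 24: writing E_{4,1}(τ,z) = Σ_{n≥0,l∈ℤ} a(n,l)q^nζ^l and E_{6,1}(τ,z) = Σ_{n≥0,l∈ℤ} b(n,l)q^nζ^l, one has a(n,l), b(n,l) ∈ ℤ and a(n,l) ≡ b(n,l) (mod 24) for all n ∈ ℕ, l ∈ ℤ. -/

import Mathlib

noncomputable section

open Complex

namespace JacobiPaper

/-- `e2 w = e^{2 π i w}`. -/
def e2 (w : ℂ) : ℂ := Complex.exp (2 * (Real.pi : ℂ) * Complex.I * w)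

/-- `q = e^{2 π i τ}`. -/
def qC (τ : ℂ) : ℂ := e2 τ

/-- `ζ = e^{2 π i z}`. -/
def zetaC (z : ℂ) : ℂ := e2 z

/-- The Dedekind eta function `η(τ) = q^{1/24} ∏_{n ≥ 1} (1 - qⁿ)`. -/
def eta (τ : ℂ) : ℂ :=
  Complex.exp ((Real.pi : ℂ) * Complex.I * τ / 12) * ∏' n : ℕ, (1 - qC τ ^ (n + 1))

/-- The odd Jacobi theta function
`ϑ(τ,z) = q^{1/8} (ζ^{1/2} - ζ^{-1/2}) ∏_{n ≥ 1} (1 - qⁿζ)(1 - qⁿζ⁻¹)(1 - qⁿ)`. -/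
def theta (τ z : ℂ) : ℂ :=
  Complex.exp ((Real.pi : ℂ) * Complex.I * τ / 4) *
    (Complex.exp ((Real.pi : ℂ) * Complex.I * z) - Complex.exp (-((Real.pi : ℂ) * Complex.I * z))) *
    ∏' n : ℕ,
      ((1 - qC τ ^ (n + 1) * zetaC z) * (1 - qC τ ^ (n + 1) * (zetaC z)⁻¹) * (1 - qC τ ^ (n + 1)))

/-- `ϑ₀₀(τ,z) = Σ_{n ∈ ℤ} q^{n²/2} ζⁿ`. -/
def theta00 (τ z : ℂ) : ℂ :=
  ∑' n : ℤ, Complex.exp ((Real.pi : ℂ) * Complex.I * (n : ℂ) ^ 2 * τ +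
    2 * (Real.pi : ℂ) * Complex.I * (n : ℂ) * z)

/-- `ϑ₀₁(τ,z) = Σ_{n ∈ ℤ} (-1)ⁿ q^{n²/2} ζⁿ`. -/
def theta01 (τ z : ℂ) : ℂ :=
  ∑' n : ℤ, (-1 : ℂ) ^ n * Complex.exp ((Real.pi : ℂ) * Complex.I * (n : ℂ) ^ 2 * τ +
    2 * (Real.pi : ℂ) * Complex.I * (n : ℂ) * z)

/-- `ϑ₁₀(τ,z) = q^{1/8} ζ^{1/2} Σ_{n ∈ ℤ} q^{n(n+1)/2} ζⁿ`. -/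
def theta10 (τ z : ℂ) : ℂ :=
  Complex.exp ((Real.pi : ℂ) * Complex.I * τ / 4) * Complex.exp ((Real.pi : ℂ) * Complex.I * z) *
    ∑' n : ℤ, Complex.exp ((Real.pi : ℂ) * Complex.I * (n : ℂ) * ((n : ℂ) + 1) * τ +
      2 * (Real.pi : ℂ) * Complex.I * (n : ℂ) * z)

/-- `ξ₀₀(τ,z) = ϑ₀₀(τ,z)/ϑ₀₀(τ,0)`. -/
def xi00 (τ z : ℂ) : ℂ := theta00 τ z / theta00 τ 0

/-- `ξ₀₁(τ,z) = ϑ₀₁(τ,z)/ϑ₀₁(τ,0)`. -/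
def xi01 (τ z : ℂ) : ℂ := theta01 τ z / theta01 τ 0

/-- `ξ₁₀(τ,z) = ϑ₁₀(τ,z)/ϑ₁₀(τ,0)`. -/
def xi10 (τ z : ℂ) : ℂ := theta10 τ z / theta10 τ 0

/-- The weak Jacobi form `φ_{0,1} = 4(ξ₀₀² + ξ₀₁² + ξ₁₀²)`. -/
def phi01 (τ z : ℂ) : ℂ := 4 * (xi00 τ z ^ 2 + xi01 τ z ^ 2 + xi10 τ z ^ 2)

/-- The weak Jacobi form `φ_{0,2}(τ,z) = 2(ξ₀₀ + ξ₀₁ + ξ₁₀)(τ,2z)`. -/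
def phi02 (τ z : ℂ) : ℂ := 2 * (xi00 τ (2 * z) + xi01 τ (2 * z) + xi10 τ (2 * z))

/-- The weak Jacobi form `φ_{0,3}(τ,z) = ϑ(τ,2z)²/ϑ(τ,z)²`. -/
def phi03 (τ z : ℂ) : ℂ := theta τ (2 * z) ^ 2 / theta τ z ^ 2

/-- The weak Jacobi form `φ_{0,4}(τ,z) = ϑ(τ,3z)/ϑ(τ,z)`. -/
def phi04 (τ z : ℂ) : ℂ := theta τ (3 * z) / theta τ z

/-- The weak Jacobi form `φ_{-2,1}(τ,z) = ϑ(τ,z)²/η(τ)⁶`. -/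
def phiM21 (τ z : ℂ) : ℂ := theta τ z ^ 2 / eta τ ^ 6

/-- The divisor power sum `σ_k(n)`. -/
def sigma' (k n : ℕ) : ℕ := ∑ d ∈ n.divisors, d ^ k

/-- The normalized Eisenstein series `E_k(τ) = 1 - (2k/B_k) Σ_{n ≥ 1} σ_{k-1}(n) qⁿ`. -/
def Eis (k : ℕ) (τ : ℂ) : ℂ :=
  1 - (2 * (k : ℂ) / ((bernoulli k : ℚ) : ℂ)) *
    ∑' n : ℕ, (sigma' (k - 1) (n + 1) : ℂ) * qC τ ^ (n + 1)

/-- The discriminant cusp form `Δ = η²⁴`. -/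
def Delta (τ : ℂ) : ℂ := eta τ ^ 24

/-- The modular invariant `j = E₄³/Δ`. -/
def jInv (τ : ℂ) : ℂ := Eis 4 τ ^ 3 / Delta τ

/-- A choice of `(a, b)` with `a d - b c = 1` completing a coprime pair `(c, d)` to a matrix
`(a b; c d) ∈ SL₂(ℤ)`. -/
def bezout (c d : ℤ) : ℤ × ℤ :=
  haveI : Decidable (∃ ab : ℤ × ℤ, ab.1 * d - ab.2 * c = 1) := Classical.propDecidable _
  if h : ∃ ab : ℤ × ℤ, ab.1 * d - ab.2 * c = 1 then h.choose else 0

/-- The summand `(cτ+d)^{-k} Σ_{l ∈ ℤ} e^{2πim(l²(aτ+b)/(cτ+d) + 2lz/(cτ+d) - cz²/(cτ+d))}`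
of the Jacobi–Eisenstein series attached to a coprime pair `(c,d)`; it does not depend on the
choice of `(a,b)` completing `(c,d)` to an element of `SL₂(ℤ)`. -/
def EisJSummand (k m : ℕ) (τ z : ℂ) (c d : ℤ) : ℂ :=
  ((c : ℂ) * τ + (d : ℂ)) ^ (-(k : ℤ)) *
    ∑' l : ℤ, e2 ((m : ℂ) * ((l : ℂ) ^ 2 * (((bezout c d).1 : ℂ) * τ + ((bezout c d).2 : ℂ)) /
        ((c : ℂ) * τ + (d : ℂ)) +
      2 * (l : ℂ) * z / ((c : ℂ) * τ + (d : ℂ)) - (c : ℂ) * z ^ 2 / ((c : ℂ) * τ + (d : ℂ))))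

/-- The Jacobi–Eisenstein series `E_{k,m}` of weight `k` and index `m`. -/
def EisJ (k m : ℕ) (τ z : ℂ) : ℂ :=
  (1 / 2) * ∑' p : {p : ℤ × ℤ // IsCoprime p.1 p.2}, EisJSummand k m τ z p.1.1 p.1.2

/-- `F_{6,3} = (1/2)(E_{6,1} φ_{0,2} - E₆ φ_{0,3})`. -/
def F63 (τ z : ℂ) : ℂ := (1 / 2) * (EisJ 6 1 τ z * phi02 τ z - Eis 6 τ * phi03 τ z)

/-- A weak Jacobi form of weight `k ∈ ℤ` and index `m ∈ ℕ`: a holomorphic function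
`φ : ℍ × ℂ → ℂ` satisfying the two Jacobi transformation laws and having a Fourier expansion
`φ(τ,z) = Σ_{n ≥ 0, l ∈ ℤ} f(n,l) qⁿ ζˡ`. -/
def IsWeakJacobiForm (k : ℤ) (m : ℕ) (φ : ℂ → ℂ → ℂ) (f : ℕ → ℤ → ℂ) : Prop :=
  DifferentiableOn ℂ (fun p : ℂ × ℂ => φ p.1 p.2) {p : ℂ × ℂ | 0 < p.1.im} ∧
  (∀ a b c d : ℤ, a * d - b * c = 1 → ∀ τ z : ℂ, 0 < τ.im →
    φ (((a : ℂ) * τ + (b : ℂ)) / ((c : ℂ) * τ + (d : ℂ))) (z / ((c : ℂ) * τ + (d : ℂ))) =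
      ((c : ℂ) * τ + (d : ℂ)) ^ k *
        e2 ((m : ℂ) * ((c : ℂ) * z ^ 2 / ((c : ℂ) * τ + (d : ℂ)))) * φ τ z) ∧
  (∀ x y : ℤ, ∀ τ z : ℂ, 0 < τ.im →
    φ τ (z + (x : ℂ) * τ + (y : ℂ)) =
      e2 (-(m : ℂ) * ((x : ℂ) ^ 2 * τ + 2 * (x : ℂ) * z)) * φ τ z) ∧
  (∀ τ z : ℂ, 0 < τ.im →
    HasSum (fun p : ℕ × ℤ => f p.1 p.2 * e2 ((p.1 : ℂ) * τ + (p.2 : ℂ) * z)) (φ τ z))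

/-- A weakly holomorphic Jacobi form of weight `0` and index `m ∈ ℕ`: as a weak Jacobi form,
but the Fourier expansion `φ(τ,z) = Σ_{n ≥ n₀, l ∈ ℤ} f(n,l) qⁿ ζˡ` may contain finitely many
negative powers of `q`. -/
def IsWeaklyHolomorphicJacobiForm0 (m : ℕ) (φ : ℂ → ℂ → ℂ) (f : ℤ → ℤ → ℂ) : Prop :=
  DifferentiableOn ℂ (fun p : ℂ × ℂ => φ p.1 p.2) {p : ℂ × ℂ | 0 < p.1.im} ∧
  (∀ a b c d : ℤ, a * d - b * c = 1 → ∀ τ z : ℂ, 0 < τ.im →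
    φ (((a : ℂ) * τ + (b : ℂ)) / ((c : ℂ) * τ + (d : ℂ))) (z / ((c : ℂ) * τ + (d : ℂ))) =
      e2 ((m : ℂ) * ((c : ℂ) * z ^ 2 / ((c : ℂ) * τ + (d : ℂ)))) * φ τ z) ∧
  (∀ x y : ℤ, ∀ τ z : ℂ, 0 < τ.im →
    φ τ (z + (x : ℂ) * τ + (y : ℂ)) =
      e2 (-(m : ℂ) * ((x : ℂ) ^ 2 * τ + 2 * (x : ℂ) * z)) * φ τ z) ∧
  (∃ n₀ : ℤ, ∀ n : ℤ, n < n₀ → ∀ l : ℤ, f n l = 0) ∧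
  (∀ τ z : ℂ, 0 < τ.im →
    HasSum (fun p : ℤ × ℤ => f p.1 p.2 * e2 ((p.1 : ℂ) * τ + (p.2 : ℂ) * z)) (φ τ z))

/-- A function `φ` on `ℍ × ℂ` has integral Fourier coefficients if it is the sum of a Fourier
series `Σ_{n ≥ 0, l ∈ ℤ} f(n,l) qⁿ ζˡ` with all `f(n,l) ∈ ℤ`. -/
def HasIntegralFourierExpansion (φ : ℂ → ℂ → ℂ) : Prop :=
  ∃ f : ℕ → ℤ → ℤ, ∀ τ z : ℂ, 0 < τ.im →
    HasSum (fun p : ℕ × ℤ => (f p.1 p.2 : ℂ) * e2 ((p.1 : ℂ) * τ + (p.2 : ℂ) * z)) (φ τ z)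

section

open Filter Topology

/-- The formal power series `f` converges (unconditionally) to `v` at `q`. -/
def EvalsTo (f : PowerSeries ℤ) (q v : ℂ) : Prop :=
  HasSum (fun n : ℕ => ((PowerSeries.coeff n f : ℤ) : ℂ) * q ^ n) v

namespace EvalsTo

variable {f g : PowerSeries ℤ} {q v w : ℂ}

theorem add (hf : EvalsTo f q v) (hg : EvalsTo g q w) : EvalsTo (f + g) q (v + w) := by
  simpa [EvalsTo, add_mul] using HasSum.add hf hg

theorem sub (hf : EvalsTo f q v) (hg : EvalsTo g q w) : EvalsTo (f - g) q (v - w) := by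
  simpa [EvalsTo, sub_mul] using HasSum.sub hf hg

theorem mul (hf : EvalsTo f q v) (hg : EvalsTo g q w) : EvalsTo (f * g) q (v * w) := by
  have hs := summable_norm_sum_mul_antidiagonal_of_summable_norm hf.summable.norm hg.summable.norm
  have ht := tsum_mul_tsum_eq_tsum_sum_antidiagonal_of_summable_norm hf.summable.norm
    hg.summable.norm
  rw [hf.tsum_eq, hg.tsum_eq] at ht
  rw [ht]
  refine hs.of_norm.hasSum.congr_fun fun n => ?_
  rw [PowerSeries.coeff_mul]
  push_cast
  rw [Finset.sum_mul]
  refine Finset.sum_congr rfl fun p hp => ?_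
  rw [Finset.HasAntidiagonal.mem_antidiagonal] at hp
  rw [← hp, pow_add]
  ring

theorem intCast (m : ℤ) (q : ℂ) : EvalsTo (PowerSeries.C m) q m := by
  have := hasSum_single
    (f := fun n : ℕ => ((PowerSeries.coeff n (PowerSeries.C m) : ℤ) : ℂ) * q ^ n)
    0 (fun n hn => by rw [PowerSeries.coeff_C, if_neg hn, Int.cast_zero, zero_mul])
  rw [PowerSeries.coeff_zero_C, pow_zero, mul_one] at this
  exact this

theorem ofNat (n : ℕ) [n.AtLeastTwo] (q : ℂ) :
    EvalsTo (OfNat.ofNat n : PowerSeries ℤ) q (OfNat.ofNat n) := by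
  simpa using intCast (OfNat.ofNat n) q

theorem one (q : ℂ) : EvalsTo 1 q 1 := by
  simpa using intCast 1 q

theorem pow (hf : EvalsTo f q v) (n : ℕ) : EvalsTo (f ^ n) q (v ^ n) := by
  induction n with
  | zero => simpa using one q
  | succ n ih => simpa [pow_succ] using ih.mul hf

theorem X (q : ℂ) : EvalsTo PowerSeries.X q q := by
  have := hasSum_single
    (f := fun n : ℕ => ((PowerSeries.coeff n (PowerSeries.X : PowerSeries ℤ) : ℤ) : ℂ) * q ^ n)
    1 (fun n hn => by simp [PowerSeries.coeff_X, hn])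
  simpa [EvalsTo] using this

theorem mk_extend {e : ℕ → ℕ} (he : Function.Injective e) (h : HasSum (fun m => q ^ e m) v) :
    EvalsTo (PowerSeries.mk (Function.extend e 1 0)) q v := by
  rw [← hasSum_extend_zero he] at h
  refine h.congr_fun fun n => ?_
  by_cases hn : ∃ m, e m = n
  · obtain ⟨m, rfl⟩ := hn
    simp [he.extend_apply]
  · simp [Function.extend_apply' _ _ _ hn]

/-- A power series is determined by its values near `0`. -/
theorem eq_of_forall (F : ℂ → ℂ) (hf : ∀ q : ℂ, ‖q‖ < 1 → EvalsTo f q (F q))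
    (hg : ∀ q : ℂ, ‖q‖ < 1 → EvalsTo g q (F q)) : f = g := by
  have key : ∀ h : PowerSeries ℤ, (∀ q : ℂ, ‖q‖ < 1 → EvalsTo h q (F q)) →
      HasFPowerSeriesAt F
        (FormalMultilinearSeries.ofScalars ℂ fun n => ((PowerSeries.coeff n h : ℤ) : ℂ)) 0 := by
    intro h hh
    rw [hasFPowerSeriesAt_iff]
    filter_upwards [Metric.ball_mem_nhds (0 : ℂ) one_pos] with q hq
    have := hh q (by simpa using hq)
    simpa [EvalsTo, mul_comm] using this
  have := (key f hf).eq_formalMultilinearSeries (key g hg)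
  ext n
  have h2 := congrArg (fun p => FormalMultilinearSeries.coeff p n) this
  simpa using h2

end EvalsTo

/-- A sum over a type split into the images of two injections. -/
theorem hasSum_of_injective_of_injective {α β γ : Type*} {f : γ → ℂ} {i : α → γ} {j : β → γ}
    (hi : Function.Injective i) (hj : Function.Injective j) (hij : ∀ a b, i a ≠ j b)
    (hcov : ∀ c, (∃ a, i a = c) ∨ ∃ b, j b = c) {s t : ℂ}
    (hs : HasSum (fun a => f (i a)) s) (ht : HasSum (fun b => f (j b)) t) : HasSum f (s + t) := by
  rw [← hasSum_extend_zero hi] at hs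
  rw [← hasSum_extend_zero hj] at ht
  refine (hs.add ht).congr_fun fun c => ?_
  rcases hcov c with ⟨a, rfl⟩ | ⟨b, rfl⟩
  · rw [hi.extend_apply, Function.extend_apply' _ _ _ (by
      rintro ⟨b, hb⟩
      exact hij a b hb.symm)]
    simp
  · rw [hj.extend_apply, Function.extend_apply' _ _ _ (by
      rintro ⟨a, ha⟩
      exact hij a b ha)]
    simp

theorem hasSum_int_of_even_of_odd {f : ℤ → ℂ} {s t : ℂ} (hs : HasSum (fun n : ℤ => f (2 * n)) s)
    (ht : HasSum (fun n : ℤ => f (2 * n + 1)) t) : HasSum f (s + t) := by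
  refine hasSum_of_injective_of_injective (i := fun n : ℤ => 2 * n) (j := fun n : ℤ => 2 * n + 1)
    (fun a b h => by simpa using h) (fun a b h => by simpa using h)
    (fun a b => by omega) (fun c => ?_) hs ht
  rcases Int.even_or_odd' c with ⟨k, rfl | rfl⟩
  · exact Or.inl ⟨k, rfl⟩
  · exact Or.inr ⟨k, rfl⟩

/-- The norm form of the Hurwitz quaternions, in the coordinates
`(a, a + 2b, a + 2c, a + 2d) / 2`. -/
def hurwitzForm (v : ℤ × ℤ × ℤ × ℤ) : ℤ :=
  v.1 ^ 2 + v.1 * v.2.1 + v.1 * v.2.2.1 + v.1 * v.2.2.2 + v.2.1 ^ 2 + v.2.2.1 ^ 2 + v.2.2.2 ^ 2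

/-- Multiplication by the unit `(-1 + i + j + k) / 2` of order three. -/
def hurwitzRotation (v : ℤ × ℤ × ℤ × ℤ) : ℤ × ℤ × ℤ × ℤ :=
  (-2 * v.1 - v.2.1 - v.2.2.1 - v.2.2.2, v.1 + v.2.2.2, v.1 + v.2.1, v.1 + v.2.2.1)

theorem hurwitzForm_hurwitzRotation (v : ℤ × ℤ × ℤ × ℤ) :
    hurwitzForm (hurwitzRotation v) = hurwitzForm v := by
  simp only [hurwitzForm, hurwitzRotation]
  ring

theorem hurwitzRotation_iterate_three (v : ℤ × ℤ × ℤ × ℤ) :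
    hurwitzRotation (hurwitzRotation (hurwitzRotation v)) = v := by
  obtain ⟨a, b, c, d⟩ := v
  simp only [hurwitzRotation, Prod.mk.injEq]
  refine ⟨?_, ?_, ?_, ?_⟩ <;> ring

theorem eq_zero_of_hurwitzRotation_eq {v : ℤ × ℤ × ℤ × ℤ} (h : hurwitzRotation v = v) : v = 0 := by
  obtain ⟨a, b, c, d⟩ := v
  simp only [hurwitzRotation, Prod.mk.injEq, Prod.mk_eq_zero] at h ⊢
  omega

theorem four_mul_hurwitzForm (v : ℤ × ℤ × ℤ × ℤ) :
    4 * hurwitzForm v = v.1 ^ 2 + (v.1 + 2 * v.2.1) ^ 2 + (v.1 + 2 * v.2.2.1) ^ 2 +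
      (v.1 + 2 * v.2.2.2) ^ 2 := by
  simp only [hurwitzForm]
  ring

theorem hurwitzForm_nonneg (v : ℤ × ℤ × ℤ × ℤ) : 0 ≤ hurwitzForm v := by
  have := four_mul_hurwitzForm v
  have : 0 ≤ 4 * hurwitzForm v := by rw [this]; positivity
  linarith

theorem eq_zero_of_hurwitzForm_eq_zero {v : ℤ × ℤ × ℤ × ℤ} (h : hurwitzForm v = 0) : v = 0 := by
  have h4 := four_mul_hurwitzForm v
  obtain ⟨a, b, c, d⟩ := v
  simp only [h] at h4
  have h1 : a = 0 := by
    nlinarith [sq_nonneg a, sq_nonneg (a + 2 * b), sq_nonneg (a + 2 * c), sq_nonneg (a + 2 * d)]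
  have h2 : a + 2 * b = 0 := by
    nlinarith [sq_nonneg a, sq_nonneg (a + 2 * b), sq_nonneg (a + 2 * c), sq_nonneg (a + 2 * d)]
  have h3 : a + 2 * c = 0 := by
    nlinarith [sq_nonneg a, sq_nonneg (a + 2 * b), sq_nonneg (a + 2 * c), sq_nonneg (a + 2 * d)]
  have h5 : a + 2 * d = 0 := by
    nlinarith [sq_nonneg a, sq_nonneg (a + 2 * b), sq_nonneg (a + 2 * c), sq_nonneg (a + 2 * d)]
  simp only [Prod.mk_eq_zero]
  omega

/-- The theta series of the Hurwitz quaternions. -/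
def hurwitzSeries : PowerSeries ℤ :=
  PowerSeries.mk fun n => (Nat.card ((fun v => (hurwitzForm v).toNat) ⁻¹' {n}) : ℤ)

theorem three_dvd_card_hurwitzForm_fiber {n : ℕ} (hn : n ≠ 0) :
    3 ∣ Nat.card ((fun v => (hurwitzForm v).toNat) ⁻¹' {n}) := by
  classical
  rcases finite_or_infinite ((fun v => (hurwitzForm v).toNat) ⁻¹' {n}) with hfin | hinf
  · have := Fintype.ofFinite ((fun v => (hurwitzForm v).toNat) ⁻¹' {n})
    let f : Function.End ((fun v => (hurwitzForm v).toNat) ⁻¹' {n}) := fun v =>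
      ⟨hurwitzRotation v.1, by
        rw [Set.mem_preimage, hurwitzForm_hurwitzRotation]
        exact v.2⟩
    have hf : f ^ 3 ^ 1 = 1 := by
      funext v
      exact Subtype.ext (hurwitzRotation_iterate_three v.1)
    have hfix : IsEmpty f.fixedPoints := by
      refine ⟨fun v => hn ?_⟩
      have h1 : hurwitzRotation v.1.1 = v.1.1 := congrArg Subtype.val v.2
      have h2 := v.1.2
      rw [Set.mem_preimage, eq_zero_of_hurwitzRotation_eq h1] at h2
      simpa [hurwitzForm] using h2.symm
    have : Fact (Nat.Prime 3) := ⟨Nat.prime_three⟩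
    have h := Equiv.Perm.card_fixedPoints_modEq hf
    rw [Fintype.card_eq_zero (α := f.fixedPoints)] at h
    rw [Nat.card_eq_fintype_card]
    exact (Nat.modEq_zero_iff_dvd).mp h
  · simp

theorem exists_hurwitzSeries_eq : ∃ H : PowerSeries ℤ, hurwitzSeries = 1 + 3 * H := by
  refine ⟨PowerSeries.mk fun n => if n = 0 then 0 else
    ((Nat.card ((fun v => (hurwitzForm v).toNat) ⁻¹' {n}) / 3 : ℕ) : ℤ), ?_⟩
  ext n
  have h3 : (3 : PowerSeries ℤ) = PowerSeries.C 3 := by simp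
  rw [hurwitzSeries, map_add, h3, PowerSeries.coeff_C_mul, PowerSeries.coeff_mk,
    PowerSeries.coeff_mk, PowerSeries.coeff_one]
  by_cases hn : n = 0
  · subst hn
    have : ((fun v => (hurwitzForm v).toNat) ⁻¹' {0}) = {0} := by
      ext v
      simp only [Set.mem_preimage, Set.mem_singleton_iff]
      refine ⟨fun h => eq_zero_of_hurwitzForm_eq_zero ?_, fun h => by simp [h, hurwitzForm]⟩
      have := hurwitzForm_nonneg v
      omega
    rw [this]
    simp
  · have := three_dvd_card_hurwitzForm_fiber hn
    simp only [hn, if_false]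
    omega

/-- `1 + 2 ∑_{n ≥ 1} q^{n²}` is the theta series of `ℤ`; this is `∑_{n ≥ 0} q^{(n+1)²}`. -/
def squareSeries : PowerSeries ℤ := PowerSeries.mk (Function.extend (fun m => (m + 1) ^ 2) 1 0)

/-- `∑_{n ≥ 0} q^{n² + n}`. -/
def pronicSeries : PowerSeries ℤ := PowerSeries.mk (Function.extend (fun m => m ^ 2 + m) 1 0)

/-- The theta series `∑_{n ∈ ℤ} q^{n²}`. -/
def intSquareSeries : PowerSeries ℤ := 1 + 2 * squareSeries

theorem summable_pow_of_le {q : ℂ} (hq : ‖q‖ < 1) {e : ℕ → ℕ} (he : ∀ n, n ≤ e n) :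
    Summable fun n => q ^ e n := by
  refine Summable.of_norm_bounded (summable_geometric_of_lt_one (norm_nonneg q) hq) fun n => ?_
  rw [norm_pow]
  exact pow_le_pow_of_le_one (norm_nonneg q) hq.le (he n)

theorem exists_evalsTo_squareSeries {q : ℂ} (hq : ‖q‖ < 1) :
    ∃ x, EvalsTo intSquareSeries q x ∧ HasSum (fun n : ℤ => q ^ (n ^ 2).toNat) x := by
  have h := (summable_pow_of_le hq (e := fun m => (m + 1) ^ 2) (fun n => by nlinarith)).hasSum
  refine ⟨_, (EvalsTo.one q).add ((EvalsTo.ofNat 2 q).mul (EvalsTo.mk_extend ?_ h)), ?_⟩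
  · intro a b hab
    simpa using Nat.pow_left_injective (n := 2) (by norm_num) hab
  · have h0 : HasSum (fun n : ℕ => q ^ (((n : ℤ)) ^ 2).toNat) (1 + ∑' m : ℕ, q ^ (m + 1) ^ 2) := by
      have := (hasSum_nat_add_iff (f := fun n : ℕ => q ^ n ^ 2) 1).mp h
      rw [Finset.sum_range_one, zero_pow two_ne_zero, pow_zero, add_comm] at this
      refine this.congr_fun fun n => ?_
      norm_cast
    have h1 : HasSum (fun n : ℕ => q ^ ((-((n : ℤ) + 1)) ^ 2).toNat) (∑' m : ℕ, q ^ (m + 1) ^ 2) := by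
      refine h.congr_fun fun n => ?_
      rw [neg_sq]
      norm_cast
    have := HasSum.of_nat_of_neg_add_one (f := fun n : ℤ => q ^ (n ^ 2).toNat) h0 h1
    rwa [add_assoc, ← two_mul] at this

theorem exists_evalsTo_pronicSeries {q : ℂ} (hq : ‖q‖ < 1) :
    ∃ y, EvalsTo pronicSeries q y ∧ HasSum (fun n : ℤ => q ^ (n ^ 2 + n).toNat) (2 * y) := by
  have h := (summable_pow_of_le hq (e := fun m => m ^ 2 + m) (fun n => by nlinarith)).hasSum
  refine ⟨_, EvalsTo.mk_extend ?_ h, ?_⟩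
  · intro a b hab
    dsimp only at hab
    nlinarith
  · have h0 : HasSum (fun n : ℕ => q ^ ((n : ℤ) ^ 2 + n).toNat) (∑' m : ℕ, q ^ (m ^ 2 + m)) := by
      refine h.congr_fun fun n => ?_
      norm_cast
    have h1 : HasSum (fun n : ℕ => q ^ ((-((n : ℤ) + 1)) ^ 2 + -((n : ℤ) + 1)).toNat)
        (∑' m : ℕ, q ^ (m ^ 2 + m)) := by
      refine h.congr_fun fun n => ?_
      rw [show (-((n : ℤ) + 1)) ^ 2 + -((n : ℤ) + 1) = ((n ^ 2 + n : ℕ) : ℤ) by push_cast; ring]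
      norm_cast
    have := HasSum.of_nat_of_neg_add_one (f := fun n : ℤ => q ^ (n ^ 2 + n).toNat) h0 h1
    rwa [← two_mul] at this

theorem hasSum_mul_complex {ι κ : Type*} {f : ι → ℂ} {g : κ → ℂ} {s t : ℂ} (hf : HasSum f s)
    (hg : HasSum g t) : HasSum (fun v : ι × κ => f v.1 * g v.2) (s * t) :=
  hf.mul hg (summable_mul_of_summable_norm hf.summable.norm hg.summable.norm)

theorem hasSum_mul_four {ι : Type*} {f : ι → ℂ} {s : ℂ} (h : HasSum f s) :
    HasSum (fun v : ι × ι × ι × ι => f v.1 * (f v.2.1 * (f v.2.2.1 * f v.2.2.2))) (s ^ 4) := by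
  have h4 := hasSum_mul_complex h (hasSum_mul_complex h (hasSum_mul_complex h h))
  rw [show s * (s * (s * s)) = s ^ 4 by ring] at h4
  exact h4

theorem pow_toNat_add (q : ℂ) {a b : ℤ} (ha : 0 ≤ a) (hb : 0 ≤ b) :
    q ^ (a + b).toNat = q ^ a.toNat * q ^ b.toNat := by
  rw [Int.toNat_add ha hb, pow_add]

theorem evalsTo_hurwitzSeries {q x y : ℂ} (hx : HasSum (fun n : ℤ => q ^ (n ^ 2).toNat) x)
    (hy : HasSum (fun n : ℤ => q ^ (n ^ 2 + n).toNat) y) :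
    EvalsTo hurwitzSeries q (x ^ 4 + q * y ^ 4) := by
  have key : HasSum (fun v => q ^ (hurwitzForm v).toNat) (x ^ 4 + q * y ^ 4) := by
    refine hasSum_of_injective_of_injective
      (i := fun v : ℤ × ℤ × ℤ × ℤ => (2 * v.1, v.2.1 - v.1, v.2.2.1 - v.1, v.2.2.2 - v.1))
      (j := fun v : ℤ × ℤ × ℤ × ℤ => (2 * v.1 + 1, v.2.1 - v.1, v.2.2.1 - v.1, v.2.2.2 - v.1))
      ?_ ?_ ?_ ?_ ((hasSum_mul_four hx).congr_fun ?_)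
      (((hasSum_mul_four hy).mul_left q).congr_fun ?_)
    · rintro ⟨a, b, c, d⟩ ⟨a', b', c', d'⟩ h
      simp only [Prod.mk.injEq] at h ⊢
      omega
    · rintro ⟨a, b, c, d⟩ ⟨a', b', c', d'⟩ h
      simp only [Prod.mk.injEq] at h ⊢
      omega
    · rintro ⟨a, b, c, d⟩ ⟨a', b', c', d'⟩ h
      simp only [Prod.mk.injEq] at h
      omega
    · rintro ⟨a, b, c, d⟩
      rcases Int.even_or_odd' a with ⟨e, rfl | rfl⟩
      · exact Or.inl ⟨(e, b + e, c + e, d + e), by simp⟩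
      · exact Or.inr ⟨(e, b + e, c + e, d + e), by simp⟩
    · rintro ⟨a, b, c, d⟩
      rw [show hurwitzForm (2 * a, b - a, c - a, d - a) = a ^ 2 + (b ^ 2 + (c ^ 2 + d ^ 2)) by
        simp only [hurwitzForm]; ring]
      rw [pow_toNat_add, pow_toNat_add, pow_toNat_add] <;> positivity
    · rintro ⟨a, b, c, d⟩
      have hp : ∀ n : ℤ, 0 ≤ n ^ 2 + n := fun n => by
        rcases le_or_gt 0 n with h | h <;> nlinarith
      rw [show hurwitzForm (2 * a + 1, b - a, c - a, d - a) =
        1 + ((a ^ 2 + a) + ((b ^ 2 + b) + ((c ^ 2 + c) + (d ^ 2 + d)))) by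
        simp only [hurwitzForm]; ring]
      have ha := hp a
      have hb := hp b
      have hc := hp c
      have hd := hp d
      rw [pow_toNat_add q zero_le_one (by omega), pow_toNat_add q ha (by omega),
        pow_toNat_add q hb (by omega), pow_toNat_add q hc hd, Int.toNat_one, pow_one]
  refine (key.tsum_fiberwise fun v => (hurwitzForm v).toNat).congr_fun fun n => ?_
  rw [tsum_congr (g := fun _ => q ^ n) (fun b => by
    have := b.2
    rw [Set.mem_preimage, Set.mem_singleton_iff] at this
    rw [this]), tsum_const]
  simp [hurwitzSeries]

theorem hurwitzSeries_eq :
    hurwitzSeries = intSquareSeries ^ 4 + 16 * PowerSeries.X * pronicSeries ^ 4 := by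
  have h : ∀ q : ℂ, ‖q‖ < 1 → ∃ v, EvalsTo hurwitzSeries q v ∧
      EvalsTo (intSquareSeries ^ 4 + 16 * PowerSeries.X * pronicSeries ^ 4) q v := by
    intro q hq
    obtain ⟨x, hx, hx'⟩ := exists_evalsTo_squareSeries hq
    obtain ⟨y, hy, hy'⟩ := exists_evalsTo_pronicSeries hq
    refine ⟨_, evalsTo_hurwitzSeries hx' hy', ?_⟩
    convert (hx.pow 4).add (((EvalsTo.ofNat 16 q).mul (EvalsTo.X q)).mul (hy.pow 4)) using 1
    ring
  choose! F hF using h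
  exact EvalsTo.eq_of_forall F (fun q hq => (hF q hq).1) (fun q hq => (hF q hq).2)

/-- The series `16 q (∑_{n ≥ 0} q^{n² + n})⁴`: the fourth power of the theta constant `θ₁`. -/
def pronicFourth : PowerSeries ℤ := 16 * PowerSeries.X * pronicSeries ^ 4

theorem exists_intSquareSeries_pow_four : ∃ M : PowerSeries ℤ, intSquareSeries ^ 4 = 1 + 8 * M :=
  ⟨squareSeries + squareSeries ^ 2 + 2 * (squareSeries + squareSeries ^ 2) ^ 2, by
    rw [intSquareSeries]; ring⟩

theorem dvd_sub_even_part : (24 : PowerSeries ℤ) ∣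
    (intSquareSeries ^ 7 + 7 * intSquareSeries ^ 3 * pronicFourth) -
      (intSquareSeries ^ 11 - 22 * intSquareSeries ^ 7 * pronicFourth -
        11 * intSquareSeries ^ 3 * pronicFourth ^ 2) := by
  obtain ⟨H, hH⟩ := exists_hurwitzSeries_eq
  obtain ⟨M, hM⟩ := exists_intSquareSeries_pow_four
  rw [hurwitzSeries_eq] at hH
  have hV : pronicFourth = 8 * (2 * PowerSeries.X * pronicSeries ^ 4) := by
    rw [pronicFourth]; ring
  change intSquareSeries ^ 4 + pronicFourth = _ at hH
  generalize 2 * PowerSeries.X * pronicSeries ^ 4 = W at hV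
  generalize intSquareSeries = T at *
  have h : T ^ 7 + 7 * T ^ 3 * pronicFourth - (T ^ 11 - 22 * T ^ 7 * pronicFourth -
      11 * T ^ 3 * pronicFourth ^ 2) =
      T ^ 3 * (T ^ 4 + 7 * pronicFourth - T ^ 8 + 22 * T ^ 4 * pronicFourth +
        11 * pronicFourth ^ 2) := by ring
  rw [h]
  refine Dvd.dvd.mul_left ?_ _
  have h8 : T ^ 4 + 7 * pronicFourth - T ^ 8 + 22 * T ^ 4 * pronicFourth + 11 * pronicFourth ^ 2 =
      8 * (-M * T ^ 4 + 7 * W + 22 * T ^ 4 * W + 88 * W ^ 2) := by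
    rw [hV]
    linear_combination (-T ^ 4) * hM
  have h3 : T ^ 4 + 7 * pronicFourth - T ^ 8 + 22 * T ^ 4 * pronicFourth + 11 * pronicFourth ^ 2 =
      3 * (-H * (1 + 3 * H) + 2 * pronicFourth + 8 * T ^ 4 * pronicFourth +
        4 * pronicFourth ^ 2) := by
    linear_combination (-(T ^ 4 + pronicFourth) - 3 * H) * hH
  refine ⟨3 * (-M * T ^ 4 + 7 * W + 22 * T ^ 4 * W + 88 * W ^ 2) -
    (-H * (1 + 3 * H) + 2 * pronicFourth + 8 * T ^ 4 * pronicFourth + 4 * pronicFourth ^ 2), ?_⟩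
  linear_combination 9 * h8 - 8 * h3

theorem dvd_sub_odd_part : (24 : PowerSeries ℤ) ∣
    8 * pronicSeries ^ 3 * (pronicFourth + 7 * intSquareSeries ^ 4) -
      8 * pronicSeries ^ 3 * (pronicFourth ^ 2 - 22 * intSquareSeries ^ 4 * pronicFourth -
        11 * intSquareSeries ^ 8) := by
  obtain ⟨H, hH⟩ := exists_hurwitzSeries_eq
  rw [hurwitzSeries_eq] at hH
  change intSquareSeries ^ 4 + pronicFourth = _ at hH
  refine ⟨pronicSeries ^ 3 * (-H * (1 + 3 * H) + 2 * intSquareSeries ^ 4 +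
    8 * intSquareSeries ^ 4 * pronicFourth + 4 * intSquareSeries ^ 8), ?_⟩
  linear_combination 8 * pronicSeries ^ 3 * (-(intSquareSeries ^ 4 + pronicFourth) - 3 * H) * hH

/-- The Fourier coefficients of `P₀(q) θ₀ + q^{3/4} P₁(q) θ₁`. -/
def jacobiCoeff (P₀ P₁ : PowerSeries ℤ) (p : ℕ × ℤ) : ℤ :=
  Function.extend (fun p : ℕ × ℤ => (p.1 + (p.2 ^ 2).toNat, 2 * p.2))
    (fun p => PowerSeries.coeff p.1 P₀) 0 p +
  Function.extend (fun p : ℕ × ℤ => (p.1 + (p.2 ^ 2 + p.2 + 1).toNat, 2 * p.2 + 1))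
    (fun p => PowerSeries.coeff p.1 P₁) 0 p

theorem injective_even_index :
    Function.Injective fun p : ℕ × ℤ => (p.1 + (p.2 ^ 2).toNat, 2 * p.2) := by
  rintro ⟨m, l⟩ ⟨m', l'⟩ h
  simp only [Prod.mk.injEq] at h ⊢
  have hl : l = l' := by omega
  subst hl
  omega

theorem injective_odd_index :
    Function.Injective fun p : ℕ × ℤ => (p.1 + (p.2 ^ 2 + p.2 + 1).toNat, 2 * p.2 + 1) := by
  rintro ⟨m, l⟩ ⟨m', l'⟩ h
  simp only [Prod.mk.injEq] at h ⊢
  have hl : l = l' := by omega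
  subst hl
  omega

theorem extend_modEq {α β : Type*} {i : α → β} (hi : Function.Injective i) {N : ℤ} {f g : α → ℤ}
    (h : ∀ a, f a ≡ g a [ZMOD N]) (b : β) :
    Function.extend i f 0 b ≡ Function.extend i g 0 b [ZMOD N] := by
  by_cases hb : ∃ a, i a = b
  · obtain ⟨a, rfl⟩ := hb
    simpa [hi.extend_apply] using h a
  · rw [Function.extend_apply' _ _ _ hb, Function.extend_apply' _ _ _ hb]

theorem coeff_modEq_of_dvd_sub {N : ℤ} {f g : PowerSeries ℤ} (h : PowerSeries.C N ∣ f - g) (n : ℕ) :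
    PowerSeries.coeff n f ≡ PowerSeries.coeff n g [ZMOD N] := by
  obtain ⟨k, hk⟩ := h
  refine (Int.modEq_iff_dvd.mpr ⟨PowerSeries.coeff n k, ?_⟩).symm
  rw [← map_sub, hk, PowerSeries.coeff_C_mul]

theorem jacobiCoeff_modEq {N : ℤ} {P₀ P₁ Q₀ Q₁ : PowerSeries ℤ} (h₀ : PowerSeries.C N ∣ P₀ - Q₀)
    (h₁ : PowerSeries.C N ∣ P₁ - Q₁) (p : ℕ × ℤ) :
    jacobiCoeff P₀ P₁ p ≡ jacobiCoeff Q₀ Q₁ p [ZMOD N] :=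
  (extend_modEq injective_even_index (fun p => coeff_modEq_of_dvd_sub h₀ p.1) p).add
    (extend_modEq injective_odd_index (fun p => coeff_modEq_of_dvd_sub h₁ p.1) p)

theorem e2_add (w w' : ℂ) : e2 (w + w') = e2 w * e2 w' := by
  rw [e2, e2, e2, mul_add, Complex.exp_add]

theorem e2_natCast_mul (n : ℕ) (w : ℂ) : e2 (n * w) = e2 w ^ n := by
  rw [e2, e2, ← Complex.exp_nat_mul]
  ring_nf

theorem hasSum_jacobiCoeff {P₀ P₁ : PowerSeries ℤ} {τ z v₀ v₁ t₀ t₁ : ℂ}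
    (h₀ : EvalsTo P₀ (e2 τ) v₀) (h₁ : EvalsTo P₁ (e2 τ) v₁)
    (ht₀ : HasSum (fun l : ℤ => e2 ((l : ℂ) ^ 2 * τ + 2 * l * z)) t₀)
    (ht₁ : HasSum (fun l : ℤ => e2 (((l : ℂ) ^ 2 + l + 1) * τ + (2 * l + 1) * z)) t₁) :
    HasSum (fun p : ℕ × ℤ => (jacobiCoeff P₀ P₁ p : ℂ) * e2 ((p.1 : ℂ) * τ + (p.2 : ℂ) * z))
      (v₀ * t₀ + v₁ * t₁) := by
  have H₀ := (hasSum_extend_zero injective_even_index).mpr (hasSum_mul_complex h₀ ht₀)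
  have H₁ := (hasSum_extend_zero injective_odd_index).mpr (hasSum_mul_complex h₁ ht₁)
  refine (H₀.add H₁).congr_fun fun p => ?_
  rw [jacobiCoeff, Int.cast_add, add_mul]
  congr 1
  · by_cases hp : ∃ a : ℕ × ℤ, (a.1 + (a.2 ^ 2).toNat, 2 * a.2) = p
    · obtain ⟨⟨m, l⟩, rfl⟩ := hp
      have hl : (((l ^ 2).toNat : ℕ) : ℂ) = (l : ℂ) ^ 2 := by
        rw [← Int.cast_natCast, Int.toNat_of_nonneg (sq_nonneg l), Int.cast_pow]
      rw [injective_even_index.extend_apply _ _ (m, l), injective_even_index.extend_apply _ _ (m, l)]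
      rw [mul_assoc, ← e2_natCast_mul, ← e2_add]
      push_cast
      rw [hl]
      ring_nf
    · rw [Function.extend_apply' _ _ _ hp, Function.extend_apply' _ _ _ hp]
      simp
  · by_cases hp : ∃ a : ℕ × ℤ, (a.1 + (a.2 ^ 2 + a.2 + 1).toNat, 2 * a.2 + 1) = p
    · obtain ⟨⟨m, l⟩, rfl⟩ := hp
      have hl : (((l ^ 2 + l + 1).toNat : ℕ) : ℂ) = (l : ℂ) ^ 2 + l + 1 := by
        rw [← Int.cast_natCast, Int.toNat_of_nonneg (by nlinarith [sq_nonneg (2 * l + 1)])]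
        push_cast
        ring
      rw [injective_odd_index.extend_apply _ _ (m, l), injective_odd_index.extend_apply _ _ (m, l)]
      rw [mul_assoc, ← e2_natCast_mul, ← e2_add]
      push_cast
      rw [hl]
      ring_nf
    · rw [Function.extend_apply' _ _ _ hp, Function.extend_apply' _ _ _ hp]
      simp

/-- The theta function `θ_{1,0}(τ,z) = ∑_l q^{l²} ζ^{2l}` of index one. -/
def th0 (τ z : ℂ) : ℂ := jacobiTheta₂ (2 * z) (2 * τ)

/-- The theta function `θ_{1,1}(τ,z) = ∑_l q^{(2l+1)²/4} ζ^{2l+1}` of index one. -/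
def th1 (τ z : ℂ) : ℂ := e2 (τ / 4 + z) * jacobiTheta₂ (2 * z + τ) (2 * τ)

theorem im_two_mul_pos {τ : ℂ} (hτ : 0 < τ.im) : 0 < (2 * τ).im := by
  simpa using hτ

theorem hasSum_th0 {τ : ℂ} (hτ : 0 < τ.im) (z : ℂ) :
    HasSum (fun l : ℤ => e2 ((l : ℂ) ^ 2 * τ + 2 * l * z)) (th0 τ z) := by
  refine (hasSum_jacobiTheta₂_term (2 * z) (im_two_mul_pos hτ)).congr_fun fun l => ?_
  rw [e2, jacobiTheta₂_term]
  ring_nf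

theorem hasSum_th1 {τ : ℂ} (hτ : 0 < τ.im) (z : ℂ) :
    HasSum (fun l : ℤ => e2 ((2 * (l : ℂ) + 1) ^ 2 * τ / 4 + (2 * l + 1) * z)) (th1 τ z) := by
  refine ((hasSum_jacobiTheta₂_term (2 * z + τ) (im_two_mul_pos hτ)).mul_left
    (e2 (τ / 4 + z))).congr_fun fun l => ?_
  rw [e2, e2, jacobiTheta₂_term, ← Complex.exp_add]
  ring_nf

theorem jacobiTheta₂_half_eq {τ : ℂ} (hτ : 0 < τ.im) (z : ℂ) :
    jacobiTheta₂ z (τ / 2) = th0 τ z + th1 τ z := by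
  have hτ2 : 0 < (τ / 2).im := by
    rw [Complex.div_ofNat_im]
    positivity
  refine (hasSum_jacobiTheta₂_term z hτ2).unique (hasSum_int_of_even_of_odd ?_ ?_)
  · refine (hasSum_th0 hτ z).congr_fun fun l => ?_
    rw [e2, jacobiTheta₂_term]
    push_cast
    ring_nf
  · refine (hasSum_th1 hτ z).congr_fun fun l => ?_
    rw [e2, jacobiTheta₂_term]
    push_cast
    ring_nf

theorem e2_zero : e2 0 = 1 := by rw [e2, mul_zero, Complex.exp_zero]

theorem e2_ne_zero (w : ℂ) : e2 w ≠ 0 := Complex.exp_ne_zero _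

theorem e2_intCast (n : ℤ) : e2 n = 1 := by
  rw [e2, mul_comm]
  exact Complex.exp_int_mul_two_pi_mul_I n

theorem th0_neg (τ z : ℂ) : th0 τ (-z) = th0 τ z := by
  rw [th0, mul_neg, jacobiTheta₂_neg_left, th0]

theorem th0_add_one (τ z : ℂ) : th0 (τ + 1) z = th0 τ z := by
  rw [th0, mul_add, mul_one, jacobiTheta₂_add_right, th0]

theorem e2_one_div_four : e2 (1 / 4) = I := by
  rw [e2, show 2 * (Real.pi : ℂ) * I * (1 / 4) = Real.pi / 2 * I by ring,
    Complex.exp_pi_div_two_mul_I]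

theorem th1_add_one (τ z : ℂ) : th1 (τ + 1) z = I * th1 τ z := by
  rw [th1, mul_add, mul_one, jacobiTheta₂_add_right, ← add_assoc, jacobiTheta₂_add_left,
    show (τ + 1) / 4 + z = 1 / 4 + (τ / 4 + z) by ring, e2_add, e2_one_div_four, th1, mul_assoc]

theorem th0_add_half (τ z : ℂ) : th0 τ (z + 1 / 2) = th0 τ z := by
  rw [th0, show 2 * (z + 1 / 2) = 2 * z + 1 by ring, jacobiTheta₂_add_left, th0]

theorem th1_add_half (τ z : ℂ) : th1 τ (z + 1 / 2) = -th1 τ z := by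
  rw [th1, show 2 * (z + 1 / 2) + τ = 2 * z + τ + 1 by ring, jacobiTheta₂_add_left, th1,
    ← add_assoc, e2_add, show e2 (1 / 2) = -1 by
      rw [e2, show 2 * (Real.pi : ℂ) * I * (1 / 2) = Real.pi * I by ring, Complex.exp_pi_mul_I]]
  ring

theorem th0_half_period (τ : ℂ) : e2 (τ / 4) * th0 τ (τ / 2) = th1 τ 0 := by
  rw [th0, th1]
  ring_nf

theorem th1_half_period (τ : ℂ) : e2 (τ / 4) * th1 τ (τ / 2) = th0 τ 0 := by
  rw [th0, th1]
  rw [show 2 * (τ / 2) + τ = 0 + 2 * τ by ring, jacobiTheta₂_add_left', mul_zero, ← mul_assoc,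
    ← mul_assoc, ← e2_add]
  rw [e2, ← Complex.exp_add]
  ring_nf
  simp

/-- The automorphy factor of weight `1/2` for `τ ↦ -1/τ`, normalized by `√2`. -/
def sqrtFactor (τ : ℂ) : ℂ := (-I * (τ / 2)) ^ (1 / 2 : ℂ)

theorem re_neg_I_mul (τ : ℂ) : (-I * (τ / 2)).re = τ.im / 2 := by
  simp [Complex.div_ofNat_im]

theorem neg_I_mul_mem_slitPlane {τ : ℂ} (hτ : 0 < τ.im) : -I * (τ / 2) ∈ slitPlane := by
  refine Or.inl ?_
  rw [re_neg_I_mul]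
  positivity

theorem sqrtFactor_sq (τ : ℂ) : sqrtFactor τ ^ 2 = -I * τ / 2 := by
  rw [sqrtFactor, ← Complex.cpow_nat_mul]
  norm_num
  ring

theorem sqrtFactor_ne_zero {τ : ℂ} (hτ : 0 < τ.im) : sqrtFactor τ ≠ 0 := by
  intro h
  have h2 := sqrtFactor_sq τ
  rw [h] at h2
  have hτ0 : τ ≠ 0 := by
    rintro rfl
    simp at hτ
  rw [zero_pow two_ne_zero, eq_comm, div_eq_zero_iff] at h2
  simp [hτ0] at h2

theorem sqrtFactor_four_mul {τ : ℂ} (hτ : 0 < τ.im) :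
    (-I * (2 * τ)) ^ (1 / 2 : ℂ) = 2 * sqrtFactor τ := by
  have hne := slitPlane_ne_zero (neg_I_mul_mem_slitPlane hτ)
  rw [sqrtFactor, show -I * (2 * τ) = ((4 : ℝ) : ℂ) * (-I * (τ / 2)) by push_cast; ring,
    cpow_def_of_ne_zero (mul_ne_zero (by norm_num) hne), cpow_def_of_ne_zero hne,
    Complex.log_ofReal_mul (by norm_num) hne, add_mul, Complex.exp_add]
  congr 1
  rw [show (4 : ℝ) = 2 ^ 2 by norm_num, Real.log_pow]
  push_cast
  rw [show 2 * ((Real.log 2 : ℝ) : ℂ) * (1 / 2) = ((Real.log 2 : ℝ) : ℂ) by ring,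
    ← Complex.ofReal_exp, Real.exp_log two_pos]
  norm_num

theorem th0_neg_one_div {τ : ℂ} (hτ : 0 < τ.im) (z : ℂ) :
    th0 (-1 / τ) (z / τ) = sqrtFactor τ * e2 (z ^ 2 / τ) * (th0 τ z + th1 τ z) := by
  have hτ0 : τ ≠ 0 := by
    rintro rfl
    simp at hτ
  have hr := sqrtFactor_ne_zero hτ
  rw [← jacobiTheta₂_half_eq hτ, jacobiTheta₂_functional_equation z (τ / 2), th0, e2]
  rw [show 2 * (z / τ) = z / (τ / 2) by field_simp, show 2 * (-1 / τ) = -1 / (τ / 2) by field_simp]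
  change _ = _ * _ * (1 / sqrtFactor τ * _ * _)
  rw [show -(Real.pi : ℂ) * I * z ^ 2 / (τ / 2) = -(2 * Real.pi * I * (z ^ 2 / τ)) by field_simp,
    Complex.exp_neg]
  have := Complex.exp_ne_zero (2 * Real.pi * I * (z ^ 2 / τ))
  field_simp

theorem im_neg_one_div_pos {τ : ℂ} (hτ : 0 < τ.im) : 0 < (-1 / τ).im := by
  rw [neg_div, neg_im, one_div, inv_im, neg_div, neg_neg]
  refine div_pos hτ (normSq_pos.mpr ?_)
  rintro rfl
  simp at hτ

theorem th1_neg_one_div {τ : ℂ} (hτ : 0 < τ.im) (z : ℂ) :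
    th1 (-1 / τ) (z / τ) = sqrtFactor τ * e2 (z ^ 2 / τ) * (th0 τ z - th1 τ z) := by
  have hτ0 : τ ≠ 0 := by
    rintro rfl
    simp at hτ
  have hr := sqrtFactor_ne_zero hτ
  have h := jacobiTheta₂_half_eq (im_neg_one_div_pos hτ) (z / τ)
  have h2 := jacobiTheta₂_functional_equation (2 * z) (2 * τ)
  rw [sqrtFactor_four_mul hτ, show 2 * z / (2 * τ) = z / τ by field_simp,
    show -1 / (2 * τ) = -1 / τ / 2 by field_simp, h, ← th0, th0_neg_one_div hτ,
    show -(Real.pi : ℂ) * I * (2 * z) ^ 2 / (2 * τ) = -(2 * Real.pi * I * (z ^ 2 / τ)) by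
      field_simp, Complex.exp_neg, ← e2] at h2
  have := e2_ne_zero (z ^ 2 / τ)
  rw [neg_div] at h2 ⊢
  field_simp at h2
  linear_combination -h2

theorem differentiableAt_th0 {τ : ℂ} (hτ : 0 < τ.im) (z : ℂ) :
    DifferentiableAt ℂ (fun τ => th0 τ z) τ := by
  have h := (hasFDerivAt_jacobiTheta₂ (2 * z) (im_two_mul_pos hτ)).differentiableAt
  exact h.comp (f := fun τ : ℂ => (2 * z, 2 * τ)) τ (by fun_prop)

theorem differentiableAt_th1 {τ : ℂ} (hτ : 0 < τ.im) (z : ℂ) :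
    DifferentiableAt ℂ (fun τ => th1 τ z) τ := by
  have h := (hasFDerivAt_jacobiTheta₂ (2 * z + τ) (im_two_mul_pos hτ)).differentiableAt
  refine DifferentiableAt.mul (by unfold e2; fun_prop) ?_
  exact h.comp (f := fun τ : ℂ => (2 * z + τ, 2 * τ)) τ (by fun_prop)

end

section

open MatrixGroups

/-- The automorphy factor `cτ + d`. -/
def jac (γ : SL(2, ℤ)) (τ : ℂ) : ℂ := (γ 1 0 : ℂ) * τ + (γ 1 1 : ℂ)

/-- The Möbius action `(aτ + b) / (cτ + d)`. -/
def mob (γ : SL(2, ℤ)) (τ : ℂ) : ℂ := ((γ 0 0 : ℂ) * τ + (γ 0 1 : ℂ)) / jac γ τ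

theorem jac_ne_zero (γ : SL(2, ℤ)) {τ : ℂ} (hτ : 0 < τ.im) : jac γ τ ≠ 0 := by
  have := UpperHalfPlane.denom_ne_zero γ (⟨τ, hτ⟩ : UpperHalfPlane)
  rwa [ModularGroup.denom_apply] at this

theorem mob_im_pos (γ : SL(2, ℤ)) {τ : ℂ} (hτ : 0 < τ.im) : 0 < (mob γ τ).im := by
  have := (γ • (⟨τ, hτ⟩ : UpperHalfPlane)).im_pos
  rw [← UpperHalfPlane.coe_im, UpperHalfPlane.coe_specialLinearGroup_apply] at this
  exact this

theorem det_coe (γ : SL(2, ℤ)) :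
    (γ 0 0 : ℂ) * (γ 1 1 : ℂ) - (γ 0 1 : ℂ) * (γ 1 0 : ℂ) = 1 := by
  have := γ.det_coe
  rw [Matrix.det_fin_two] at this
  exact_mod_cast this

theorem mul_apply_coe (γ δ : SL(2, ℤ)) (i j : Fin 2) :
    ((γ * δ) i j : ℂ) = γ i 0 * δ 0 j + γ i 1 * δ 1 j := by
  rw [Matrix.SpecialLinearGroup.coe_mul, Matrix.mul_apply, Fin.sum_univ_two]
  push_cast
  rfl

theorem jac_mul (γ δ : SL(2, ℤ)) {τ : ℂ} (hτ : 0 < τ.im) :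
    jac (γ * δ) τ = jac γ (mob δ τ) * jac δ τ := by
  have := jac_ne_zero δ hτ
  rw [jac, jac.eq_1 γ, mob, mul_apply_coe, mul_apply_coe]
  field_simp
  rw [jac]
  ring

theorem mob_mul (γ δ : SL(2, ℤ)) {τ : ℂ} (hτ : 0 < τ.im) :
    mob (γ * δ) τ = mob γ (mob δ τ) := by
  have h1 := jac_ne_zero δ hτ
  have h2 := jac_ne_zero γ (mob_im_pos δ hτ)
  rw [mob, mob.eq_1 γ, jac_mul γ δ hτ, mul_apply_coe, mul_apply_coe,
    div_eq_div_iff (mul_ne_zero h2 h1) h2, mob.eq_1 δ]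
  field_simp
  rw [jac.eq_1 δ]
  ring

theorem differentiableAt_mob (γ : SL(2, ℤ)) {τ : ℂ} (hτ : 0 < τ.im) :
    DifferentiableAt ℂ (mob γ) τ :=
  DifferentiableAt.div (by fun_prop) (by unfold jac; fun_prop) (jac_ne_zero γ hτ)

/-- The vector of theta functions of index one. -/
def thetaVec (τ z : ℂ) : Fin 2 → ℂ := ![th0 τ z, th1 τ z]

/-- The vector of theta functions transforms under `γ` with a factor of automorphy of weight `1/2`
and a unitary matrix. -/
def ThetaTransforms (γ : SL(2, ℤ)) : Prop :=
  ∃ s : ℂ → ℂ, ∃ U ∈ Matrix.unitaryGroup (Fin 2) ℂ,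
    (∀ τ : ℂ, 0 < τ.im → DifferentiableAt ℂ s τ) ∧ (∀ τ : ℂ, 0 < τ.im → s τ ^ 2 = jac γ τ) ∧
    ∀ τ z : ℂ, 0 < τ.im → thetaVec (mob γ τ) (z / jac γ τ) =
      (s τ * e2 ((γ 1 0 : ℂ) * z ^ 2 / jac γ τ)) • Matrix.mulVec U (thetaVec τ z)

theorem ThetaTransforms.mul {γ δ : SL(2, ℤ)} (hγ : ThetaTransforms γ) (hδ : ThetaTransforms δ) :
    ThetaTransforms (γ * δ) := by
  obtain ⟨s, U, hU, hs, hs2, h⟩ := hγ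
  obtain ⟨t, V, hV, ht, ht2, h'⟩ := hδ
  refine ⟨fun τ => s (mob δ τ) * t τ, U * V, mul_mem hU hV, fun τ hτ => ?_, fun τ hτ => ?_,
    fun τ z hτ => ?_⟩
  · exact (DifferentiableAt.comp τ (hs _ (mob_im_pos δ hτ)) (differentiableAt_mob δ hτ)).mul
      (ht τ hτ)
  · rw [mul_pow, hs2 _ (mob_im_pos δ hτ), ht2 τ hτ, jac_mul γ δ hτ]
  · have h1 := jac_ne_zero δ hτ
    have h2 := jac_ne_zero γ (mob_im_pos δ hτ)
    rw [mob_mul γ δ hτ, jac_mul γ δ hτ, mul_comm (jac γ _), ← div_div,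
      h _ _ (mob_im_pos δ hτ), h' _ _ hτ, Matrix.mulVec_smul, Matrix.mulVec_mulVec, smul_smul]
    congr 1
    have h3 : ((γ * δ) 1 0 : ℂ) * z ^ 2 / (jac δ τ * jac γ (mob δ τ)) =
        (γ 1 0 : ℂ) * (z / jac δ τ) ^ 2 / jac γ (mob δ τ) + (δ 1 0 : ℂ) * z ^ 2 / jac δ τ := by
      have h4 := jac_mul γ δ hτ
      rw [jac.eq_1 (γ * δ), mul_apply_coe, mul_apply_coe] at h4
      rw [mul_apply_coe]
      have h5 := det_coe δ
      have h6 := jac.eq_1 δ τ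
      field_simp
      linear_combination z ^ 2 * (δ 1 0 : ℂ) * h4 + z ^ 2 * (γ 1 0 : ℂ) * h5 +
        z ^ 2 * ((γ 1 0 : ℂ) * (δ 0 0 : ℂ) + (γ 1 1 : ℂ) * (δ 1 0 : ℂ)) * h6
    rw [h3, e2_add]
    ring

theorem thetaTransforms_one : ThetaTransforms 1 := by
  refine ⟨fun _ => 1, 1, one_mem _, fun τ _ => by fun_prop, fun τ _ => ?_, fun τ z _ => ?_⟩
  · simp [jac]
  · simp [jac, mob, e2_zero]

theorem thetaTransforms_T : ThetaTransforms ModularGroup.T := by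
  refine ⟨fun _ => 1, !![1, 0; 0, I], ?_, fun τ _ => by fun_prop, fun τ _ => ?_, fun τ z _ => ?_⟩
  · rw [Matrix.mem_unitaryGroup_iff]
    ext i j
    fin_cases i <;> fin_cases j <;> simp [Matrix.mul_apply, Fin.sum_univ_two]
  · simp [jac, ModularGroup.T]
  · simp only [jac, mob, ModularGroup.T]
    ext i
    fin_cases i <;> simp [e2_zero, thetaVec, th0_add_one, th1_add_one, mul_comm]

theorem thetaTransforms_T_inv : ThetaTransforms ModularGroup.T⁻¹ := by
  refine ⟨fun _ => 1, !![1, 0; 0, -I], ?_, fun τ _ => by fun_prop, fun τ _ => ?_, fun τ z _ => ?_⟩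
  · rw [Matrix.mem_unitaryGroup_iff]
    ext i j
    fin_cases i <;> fin_cases j <;> simp [Matrix.mul_apply, Fin.sum_univ_two]
  · simp [jac]
  · have h0 := th0_add_one (τ - 1) z
    have h1 := th1_add_one (τ - 1) z
    rw [sub_add_cancel] at h0 h1
    simp only [jac, mob, ModularGroup.coe_T_inv]
    ext i
    fin_cases i <;> simp [e2_zero, thetaVec, h0, h1, mul_right_comm I _ I, ← sub_eq_add_neg]

theorem differentiableAt_sqrtFactor {τ : ℂ} (hτ : 0 < τ.im) : DifferentiableAt ℂ sqrtFactor τ :=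
  DifferentiableAt.cpow_const (by fun_prop) (neg_I_mul_mem_slitPlane hτ)

theorem thetaTransforms_S : ThetaTransforms ModularGroup.S := by
  refine ⟨fun τ => (1 + I) * sqrtFactor τ,
    !![(1 - I) / 2, (1 - I) / 2; (1 - I) / 2, -(1 - I) / 2], ?_,
    fun τ hτ => (differentiableAt_sqrtFactor hτ).const_mul _, fun τ _ => ?_, fun τ z hτ => ?_⟩
  · rw [Matrix.mem_unitaryGroup_iff]
    ext i j
    fin_cases i <;> fin_cases j <;> simp [Matrix.mul_apply, Fin.sum_univ_two] <;> ring_nf <;>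
      simp [map_ofNat] <;> norm_num
  · rw [mul_pow, sqrtFactor_sq]
    simp only [jac, ModularGroup.S]
    simp
    ring_nf
    simp
  · have h0 := th0_neg_one_div hτ z
    have h1 := th1_neg_one_div hτ z
    have hI : (1 + I) * (1 - I) = 2 := by ring_nf; simp; norm_num
    simp only [jac, mob, ModularGroup.S]
    ext i
    fin_cases i
    · simp [thetaVec, h0]
      linear_combination (-sqrtFactor τ * e2 (z ^ 2 / τ) * (th0 τ z + th1 τ z) / 2) * hI
    · simp [thetaVec, h1]
      linear_combination (-sqrtFactor τ * e2 (z ^ 2 / τ) * (th0 τ z - th1 τ z) / 2) * hI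

theorem thetaTransforms (γ : SL(2, ℤ)) : ThetaTransforms γ := by
  have hγ : γ ∈ Subgroup.closure {ModularGroup.S, ModularGroup.T} := by
    rw [SpecialLinearGroup.SL2Z_generators]
    trivial
  rw [← Subgroup.mem_toSubmonoid, Subgroup.closure_toSubmonoid] at hγ
  induction hγ using Submonoid.closure_induction with
  | mem x hx =>
    rcases hx with (rfl | rfl) | hx
    · exact thetaTransforms_S
    · exact thetaTransforms_T
    · rcases hx with hx | hx
      · rw [← inv_inv x, hx, show ModularGroup.S⁻¹ =
          ModularGroup.S * (ModularGroup.S * ModularGroup.S) by decide]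
        exact thetaTransforms_S.mul (thetaTransforms_S.mul thetaTransforms_S)
      · rw [Set.mem_singleton_iff] at hx
        rw [← inv_inv x, hx]
        exact thetaTransforms_T_inv
  | one => exact thetaTransforms_one
  | mul x y _ _ hx hy => exact hx.mul hy

theorem th0_add_natCast (τ z : ℂ) (n : ℕ) : th0 (τ + n) z = th0 τ z := by
  induction n with
  | zero => simp
  | succ n ih => rw [Nat.cast_succ, ← add_assoc, th0_add_one, ih]

theorem th0_add_intCast (τ z : ℂ) (n : ℤ) : th0 (τ + n) z = th0 τ z := by
  obtain ⟨m, rfl | rfl⟩ := n.eq_nat_or_neg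
  · exact_mod_cast th0_add_natCast τ z m
  · rw [← th0_add_natCast (τ + _) z m]
    push_cast
    rw [neg_add_cancel_right]

theorem bezout_spec {c d : ℤ} (h : ∃ ab : ℤ × ℤ, ab.1 * d - ab.2 * c = 1) :
    (bezout c d).1 * d - (bezout c d).2 * c = 1 := by
  rw [bezout, dif_pos h]
  exact h.choose_spec

theorem eisJSummand_eq (k : ℕ) (γ : SL(2, ℤ)) {τ : ℂ} (hτ : 0 < τ.im) (z : ℂ) :
    EisJSummand k 1 τ z (γ 1 0) (γ 1 1) = jac γ τ ^ (-(k : ℤ)) *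
      (e2 (-((γ 1 0 : ℂ) * z ^ 2 / jac γ τ)) * th0 (mob γ τ) (z / jac γ τ)) := by
  have hdet : γ 0 0 * γ 1 1 - γ 0 1 * γ 1 0 = 1 := by exact_mod_cast det_coe γ
  have hb := bezout_spec ⟨(γ 0 0, γ 0 1), hdet⟩
  rw [EisJSummand]
  generalize hab : bezout (γ 1 0) (γ 1 1) = ab at hb
  obtain ⟨a, b⟩ := ab
  have hj := jac_ne_zero γ hτ
  change jac γ τ ^ (-(k : ℤ)) * _ = _
  congr 1
  have h1 : mob γ τ = (a * τ + b) / jac γ τ + ((a * γ 0 1 - γ 0 0 * b : ℤ) : ℂ) := by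
    have hb' : (a : ℂ) * γ 1 1 - b * γ 1 0 = 1 := by exact_mod_cast hb
    have hd := det_coe γ
    rw [mob]
    have hj2 := jac.eq_1 γ τ
    field_simp
    push_cast
    rw [hj2]
    linear_combination (a * τ + b) * hd - ((γ 0 0 : ℂ) * τ + γ 0 1) * hb'
  have hw : 0 < ((a * τ + b) / jac γ τ).im := by
    have := mob_im_pos γ hτ
    rw [h1, add_im, intCast_im, add_zero] at this
    exact this
  rw [h1, th0_add_intCast, ← ((hasSum_th0 hw (z / jac γ τ)).mul_left _).tsum_eq]
  refine tsum_congr fun l => ?_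
  rw [← e2_add]
  congr 1
  simp only [jac]
  push_cast
  ring

theorem exists_bottom_row {c d : ℤ} (h : IsCoprime c d) :
    ∃ γ : SL(2, ℤ), γ 1 0 = c ∧ γ 1 1 = d := by
  obtain ⟨u, v, huv⟩ := h
  refine ⟨⟨!![v, -u; c, d], ?_⟩, rfl, rfl⟩
  rw [Matrix.det_fin_two_of]
  linarith

theorem eisJSummand_add_one (k : ℕ) {c d : ℤ} (h : IsCoprime c d) {τ : ℂ} (hτ : 0 < τ.im) (z : ℂ) :
    EisJSummand k 1 (τ + 1) z c d = EisJSummand k 1 τ z c (c + d) := by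
  obtain ⟨γ, rfl, rfl⟩ := exists_bottom_row h
  have hτ' : 0 < (τ + 1).im := by simpa using hτ
  have hr0 : (γ * ModularGroup.T) 1 0 = γ 1 0 := by
    rw [Matrix.SpecialLinearGroup.coe_mul, Matrix.mul_apply, Fin.sum_univ_two, ModularGroup.coe_T]
    simp
  have hr1 : (γ * ModularGroup.T) 1 1 = γ 1 0 + γ 1 1 := by
    rw [Matrix.SpecialLinearGroup.coe_mul, Matrix.mul_apply, Fin.sum_univ_two, ModularGroup.coe_T]
    simp
  have hj : jac ModularGroup.T τ = 1 := by simp [jac, ModularGroup.T]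
  have hm : mob ModularGroup.T τ = τ + 1 := by simp [mob, hj]
  rw [← hr1, ← hr0, eisJSummand_eq k _ hτ, jac_mul _ _ hτ, mob_mul _ _ hτ, hj, hm, mul_one, hr0,
    eisJSummand_eq k _ hτ']

theorem eisJSummand_neg_one_div (k : ℕ) {c d : ℤ} (h : IsCoprime c d) {τ : ℂ} (hτ : 0 < τ.im)
    (z : ℂ) : EisJSummand k 1 (-1 / τ) (z / τ) c d =
      τ ^ k * e2 (z ^ 2 / τ) * EisJSummand k 1 τ z d (-c) := by
  obtain ⟨γ, rfl, rfl⟩ := exists_bottom_row h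
  have hτ' := im_neg_one_div_pos hτ
  have hτ0 : τ ≠ 0 := by
    rintro rfl
    simp at hτ
  have hr0 : (γ * ModularGroup.S) 1 0 = γ 1 1 := by
    rw [Matrix.SpecialLinearGroup.coe_mul, Matrix.mul_apply, Fin.sum_univ_two, ModularGroup.coe_S]
    simp
  have hr1 : (γ * ModularGroup.S) 1 1 = -γ 1 0 := by
    rw [Matrix.SpecialLinearGroup.coe_mul, Matrix.mul_apply, Fin.sum_univ_two, ModularGroup.coe_S]
    simp
  have hj : jac ModularGroup.S τ = τ := by simp [jac, ModularGroup.S]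
  have hm : mob ModularGroup.S τ = -1 / τ := by simp [mob, hj]
  have hJ := jac_ne_zero γ hτ'
  have h2 : jac γ (-1 / τ) * τ = γ 1 1 * τ - γ 1 0 := by
    rw [jac]
    field_simp
    ring
  rw [← hr1, ← hr0, eisJSummand_eq k _ hτ, jac_mul _ _ hτ, mob_mul _ _ hτ, hj, hm, hr0,
    eisJSummand_eq k _ hτ', mul_zpow, zpow_neg τ, zpow_natCast, div_div, mul_comm τ (jac γ _)]
  have h3 : -((γ 1 0 : ℂ) * (z / τ) ^ 2 / jac γ (-1 / τ)) =
      z ^ 2 / τ + -((γ 1 1 : ℂ) * z ^ 2 / (jac γ (-1 / τ) * τ)) := by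
    generalize jac γ (-1 / τ) = J at *
    field_simp
    linear_combination -z ^ 2 * h2
  rw [h3, e2_add]
  field_simp

theorem EisJ_add_one (k : ℕ) {τ : ℂ} (hτ : 0 < τ.im) (z : ℂ) :
    EisJ k 1 (τ + 1) z = EisJ k 1 τ z := by
  let e : {p : ℤ × ℤ // IsCoprime p.1 p.2} ≃ {p : ℤ × ℤ // IsCoprime p.1 p.2} :=
    { toFun := fun p => ⟨(p.1.1, p.1.1 + p.1.2), by
        simpa [add_comm] using p.2.add_mul_left_right 1⟩
      invFun := fun p => ⟨(p.1.1, p.1.2 - p.1.1), by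
        simpa [sub_eq_add_neg, add_comm] using p.2.add_mul_left_right (-1)⟩
      left_inv := fun p => by simp
      right_inv := fun p => by simp }
  rw [EisJ, EisJ, ← e.tsum_eq fun p => EisJSummand k 1 τ z p.1.1 p.1.2]
  congr 1
  exact tsum_congr fun p => eisJSummand_add_one k p.2 hτ z

theorem EisJ_neg_one_div (k : ℕ) {τ : ℂ} (hτ : 0 < τ.im) (z : ℂ) :
    EisJ k 1 (-1 / τ) (z / τ) = τ ^ k * e2 (z ^ 2 / τ) * EisJ k 1 τ z := by
  let e : {p : ℤ × ℤ // IsCoprime p.1 p.2} ≃ {p : ℤ × ℤ // IsCoprime p.1 p.2} :=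
    { toFun := fun p => ⟨(p.1.2, -p.1.1), p.2.symm.neg_right⟩
      invFun := fun p => ⟨(-p.1.2, p.1.1), p.2.symm.neg_left⟩
      left_inv := fun p => by simp
      right_inv := fun p => by simp }
  rw [EisJ, EisJ, ← e.tsum_eq fun p => EisJSummand k 1 τ z p.1.1 p.1.2, mul_left_comm]
  congr 1
  rw [← tsum_mul_left]
  exact tsum_congr fun p => eisJSummand_neg_one_div k p.2 hτ z

/-- Every summand of the Jacobi–Eisenstein series of index one is a combination of the two theta
functions with holomorphic coefficients. -/
theorem exists_eisJSummand_decomposition (p : {p : ℤ × ℤ // IsCoprime p.1 p.2}) :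
    ∃ A B : ℂ → ℂ, DifferentiableOn ℂ A {τ | 0 < τ.im} ∧ DifferentiableOn ℂ B {τ | 0 < τ.im} ∧
      (∀ τ : ℂ, 0 < τ.im → ‖A τ‖ ≤ ‖(p.1.1 : ℂ) * τ + p.1.2‖ ^ (1 / 2 : ℝ)) ∧
      (∀ τ : ℂ, 0 < τ.im → ‖B τ‖ ≤ ‖(p.1.1 : ℂ) * τ + p.1.2‖ ^ (1 / 2 : ℝ)) ∧
      (p.1.1 = 0 → ∀ τ, A τ = 1 ∧ B τ = 0) ∧
      ∀ (k : ℕ) (τ z : ℂ), 0 < τ.im → EisJSummand k 1 τ z p.1.1 p.1.2 =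
        ((p.1.1 : ℂ) * τ + p.1.2) ^ (-(k : ℤ)) * (A τ * th0 τ z + B τ * th1 τ z) := by
  obtain ⟨⟨c, d⟩, h⟩ := p
  obtain ⟨γ, rfl, rfl⟩ := exists_bottom_row h
  dsimp only
  by_cases hc : γ 1 0 = 0
  · have hdet : γ 0 0 * γ 1 1 - γ 0 1 * γ 1 0 = 1 := by exact_mod_cast det_coe γ
    rw [hc, mul_zero, sub_zero] at hdet
    have hd : γ 0 0 = 1 ∧ γ 1 1 = 1 ∨ γ 0 0 = -1 ∧ γ 1 1 = -1 :=
      Int.mul_eq_one_iff_eq_one_or_neg_one.mp hdet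
    refine ⟨fun _ => 1, fun _ => 0, by fun_prop, by fun_prop, fun τ _ => ?_, fun τ _ => ?_,
      fun _ τ => ⟨rfl, rfl⟩, fun k τ z hτ => ?_⟩
    · rcases hd with hd | hd <;> simp [hc, hd.2]
    · rw [norm_zero]
      positivity
    · rw [eisJSummand_eq k γ hτ, one_mul, zero_mul, add_zero]
      change jac γ τ ^ (-(k : ℤ)) * _ = jac γ τ ^ (-(k : ℤ)) * _
      congr 1
      rw [hc, Int.cast_zero, zero_mul, zero_div, neg_zero, e2_zero, one_mul]
      rcases hd with hd | hd
      · have : jac γ τ = 1 := by simp [jac, hc, hd.2]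
        rw [mob, this, hd.1, div_one, div_one, Int.cast_one, one_mul, th0_add_intCast]
      · have : jac γ τ = -1 := by simp [jac, hc, hd.2]
        rw [mob, this, hd.1, div_neg, div_one, div_neg, div_one, th0_neg,
          show -(((-1 : ℤ) : ℂ) * τ + (γ 0 1 : ℂ)) = τ + ((-γ 0 1 : ℤ) : ℂ) by push_cast; ring,
          th0_add_intCast]
  · obtain ⟨s, U, hU, hs, hs2, hγ⟩ := thetaTransforms γ
    have hnorm : ∀ τ : ℂ, 0 < τ.im → ‖s τ‖ = ‖jac γ τ‖ ^ (1 / 2 : ℝ) := by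
      intro τ hτ
      rw [← hs2 τ hτ, norm_pow, ← Real.sqrt_eq_rpow, Real.sqrt_sq (norm_nonneg _)]
    have hb : ∀ i j, ∀ τ : ℂ, 0 < τ.im → ‖s τ * U i j‖ ≤ ‖jac γ τ‖ ^ (1 / 2 : ℝ) := by
      intro i j τ hτ
      rw [norm_mul, ← hnorm τ hτ]
      exact mul_le_of_le_one_right (norm_nonneg _) (entry_norm_bound_of_unitary hU i j)
    have hdiff : ∀ i j, DifferentiableOn ℂ (fun τ => s τ * U i j) {τ | 0 < τ.im} := fun i j τ hτ =>
      ((hs τ hτ).mul_const _).differentiableWithinAt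
    refine ⟨fun τ => s τ * U 0 0, fun τ => s τ * U 0 1, hdiff 0 0, hdiff 0 1, hb 0 0, hb 0 1,
      fun h => absurd h hc, fun k τ z hτ => ?_⟩
    rw [eisJSummand_eq k γ hτ]
    change jac γ τ ^ (-(k : ℤ)) * _ = jac γ τ ^ (-(k : ℤ)) * _
    congr 1
    have h0 := congrFun (hγ τ z hτ) 0
    simp only [thetaVec, Matrix.cons_val_zero, Pi.smul_apply, Matrix.mulVec, dotProduct,
      Fin.sum_univ_two, Matrix.cons_val_one, smul_eq_mul] at h0
    rw [h0, ← mul_assoc, mul_left_comm (e2 _) (s τ), ← e2_add, neg_add_cancel, e2_zero]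
    ring

end

section

open Filter Topology UpperHalfPlane ModularForm MatrixGroups

/-- The filter of points tending to `i∞` inside the strip `|re τ| ≤ 1`. -/
def stripAtImInfty : Filter ℂ :=
  comap Complex.im atTop ⊓ 𝓟 {τ : ℂ | |τ.re| ≤ 1}

theorem isZeroAtImInfty_of_tendsto_stripAtImInfty {F : ℂ → ℂ}
    (hT : ∀ τ : ℂ, 0 < τ.im → F (τ + 1) = F τ) (h0 : Tendsto F stripAtImInfty (𝓝 0)) :
    IsZeroAtImInfty (fun τ : ℍ => F τ) := by
  have hTn : ∀ (n : ℕ) (τ : ℂ), 0 < τ.im → F (τ + n) = F τ := by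
    intro n
    induction n with
    | zero => simp
    | succ n ih =>
      intro τ hτ
      rw [Nat.cast_succ, ← add_assoc, hT _ (by simpa using hτ), ih τ hτ]
  have hTz : ∀ (n : ℤ) (τ : ℂ), 0 < τ.im → F (τ + n) = F τ := by
    intro n τ hτ
    obtain ⟨m, rfl | rfl⟩ := n.eq_nat_or_neg
    · exact_mod_cast hTn m τ hτ
    · have := hTn m (τ + ((-(m : ℤ) : ℤ) : ℂ)) (by simpa using hτ)
      rw [← this]
      congr 1
      push_cast
      ring
  rw [isZeroAtImInfty_iff]
  intro ε hε
  have h1 := h0.eventually (Metric.ball_mem_nhds 0 hε)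
  rw [stripAtImInfty, eventually_inf_principal, eventually_comap] at h1
  obtain ⟨A, hA⟩ := eventually_atTop.mp h1
  refine ⟨A, fun z hz => ?_⟩
  rw [← hTz (-⌊z.re⌋) z z.im_pos]
  have := hA z.im hz ((z : ℂ) + ((-⌊z.re⌋ : ℤ) : ℂ)) (by simp) (by
    have h1 := Int.floor_le z.re
    have h2 := Int.lt_floor_add_one z.re
    simp only [Set.mem_ofPred_eq, add_re, Int.cast_neg]
    rw [abs_le]
    constructor <;> simp <;> linarith)
  simpa using le_of_lt (by simpa using this)

/-- A level one cusp form of weight less than `12`, given as a function on `ℂ`, vanishes. -/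
theorem eq_zero_of_cuspidal_of_weight_lt_twelve {F : ℂ → ℂ} {k : ℤ} (hk : k < 12)
    (hF : DifferentiableOn ℂ F {τ : ℂ | 0 < τ.im})
    (hT : ∀ τ : ℂ, 0 < τ.im → F (τ + 1) = F τ)
    (hS : ∀ τ : ℂ, 0 < τ.im → F (-1 / τ) = τ ^ k * F τ)
    (h0 : Tendsto F stripAtImInfty (𝓝 0)) (τ : ℂ) (hτ : 0 < τ.im) : F τ = 0 := by
  have hslash : ∀ γ : SL(2, ℤ), (fun τ : ℍ => F τ) ∣[k] γ = fun τ : ℍ => F τ := by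
    apply SlashInvariantForm.slash_action_generators_SL2Z
    · ext z
      rw [SlashInvariantForm.slash_S_apply]
      have hz : (z : ℂ) ≠ 0 := z.ne_zero
      have := hS z z.im_pos
      simp only
      rw [show (-(z : ℂ))⁻¹ = -1 / (z : ℂ) by field_simp, this]
      rw [mul_right_comm, ← zpow_add₀ hz, add_neg_cancel, zpow_zero, one_mul]
    · ext z
      have hden : denom (ModularGroup.T : SL(2, ℤ)) z = 1 := by
        rw [ModularGroup.denom_apply]
        simp [ModularGroup.T]
      rw [ModularForm.SL_slash_apply, modular_T_smul, UpperHalfPlane.coe_vadd, hden]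
      have := hT z z.im_pos
      simpa [add_comm] using this
  let f : CuspForm 𝒮ℒ k :=
    { toFun := fun τ : ℍ => F τ
      slash_action_eq' := by
        rintro _ ⟨γ, rfl⟩
        exact hslash γ
      holo' := by
        rw [UpperHalfPlane.mdifferentiable_iff]
        refine hF.congr fun z hz => ?_
        simp [UpperHalfPlane.ofComplex_apply_of_im_pos hz]
      zero_at_cusps' := by
        intro c hc
        rw [OnePoint.isZeroAt_iff_forall_SL2Z hc]
        intro γ _
        have h := hslash γ
        change IsZeroAtImInfty ((fun τ : ℍ => F τ) ∣[k] γ)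
        rw [h]
        exact isZeroAtImInfty_of_tendsto_stripAtImInfty hT h0 }
  have hf : f = 0 := rank_zero_iff_forall_zero.mp (CuspForm.rank_eq_zero_of_weight_lt_twelve hk) f
  exact DFunLike.congr_fun hf (⟨τ, hτ⟩ : ℍ)

end

section

open Filter Topology

/-- Half the sum over the bottom rows `(c, d)` of `(cτ + d)⁻ᵏ f_{c,d}(τ)`. -/
def bottomRowSum (k : ℕ) (f : {p : ℤ × ℤ // IsCoprime p.1 p.2} → ℂ → ℂ) (τ : ℂ) : ℂ :=
  (1 / 2) * ∑' p : {p : ℤ × ℤ // IsCoprime p.1 p.2},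
    ((p.1.1 : ℂ) * τ + p.1.2) ^ (-(k : ℤ)) * f p τ

theorem bottomRow_ne_zero (p : {p : ℤ × ℤ // IsCoprime p.1 p.2}) {τ : ℂ} (hτ : 0 < τ.im) :
    (p.1.1 : ℂ) * τ + p.1.2 ≠ 0 := by
  obtain ⟨⟨c, d⟩, h⟩ := p
  obtain ⟨γ, rfl, rfl⟩ := exists_bottom_row h
  exact jac_ne_zero γ hτ

theorem norm_bottomRow_term_le {k : ℕ} {f : {p : ℤ × ℤ // IsCoprime p.1 p.2} → ℂ → ℂ}
    (hb : ∀ p, ∀ τ : ℂ, 0 < τ.im → ‖f p τ‖ ≤ ‖(p.1.1 : ℂ) * τ + p.1.2‖ ^ (1 / 2 : ℝ))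
    (p : {p : ℤ × ℤ // IsCoprime p.1 p.2}) {τ : ℂ} (hτ : 0 < τ.im) :
    ‖((p.1.1 : ℂ) * τ + p.1.2) ^ (-(k : ℤ)) * f p τ‖ ≤
      ‖(p.1.1 : ℂ) * τ + p.1.2‖ ^ (-((k : ℝ) - 1 / 2)) := by
  have hpos : 0 < ‖(p.1.1 : ℂ) * τ + p.1.2‖ := norm_pos_iff.mpr (bottomRow_ne_zero p hτ)
  rw [norm_mul, norm_zpow, neg_sub, sub_eq_neg_add, Real.rpow_add hpos, ← Real.rpow_intCast]
  push_cast
  exact mul_le_mul_of_nonneg_left (hb p τ hτ) (by positivity)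

theorem exists_bottomRow_bound {k : ℕ} (hk : 4 ≤ k)
    {f : {p : ℤ × ℤ // IsCoprime p.1 p.2} → ℂ → ℂ}
    (hb : ∀ p, ∀ τ : ℂ, 0 < τ.im → ‖f p τ‖ ≤ ‖(p.1.1 : ℂ) * τ + p.1.2‖ ^ (1 / 2 : ℝ))
    (A : ℝ) {B : ℝ} (hB : 0 < B) :
    ∃ u : {p : ℤ × ℤ // IsCoprime p.1 p.2} → ℝ, Summable u ∧
      ∀ p, ∀ τ : ℂ, |τ.re| ≤ A → B ≤ τ.im →
        ‖((p.1.1 : ℂ) * τ + p.1.2) ^ (-(k : ℤ)) * f p τ‖ ≤ u p := by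
  have hk' : (4 : ℝ) ≤ k := by exact_mod_cast hk
  refine ⟨fun p => EisensteinSeries.r ⟨⟨A, B⟩, hB⟩ ^ (-((k : ℝ) - 1 / 2)) *
    ‖(![p.1.1, p.1.2] : Fin 2 → ℤ)‖ ^ (-((k : ℝ) - 1 / 2)), ?_, fun p τ hre him => ?_⟩
  · refine Summable.mul_left _ ?_
    have hinj : Function.Injective
        (fun p : {p : ℤ × ℤ // IsCoprime p.1 p.2} => (![p.1.1, p.1.2] : Fin 2 → ℤ)) := by
      intro p q h
      exact Subtype.ext (Prod.ext (congrFun h 0) (congrFun h 1))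
    exact (EisensteinSeries.summable_one_div_norm_rpow
      (show (2 : ℝ) < k - 1 / 2 by linarith)).comp_injective hinj
  · have hτ : 0 < τ.im := hB.trans_le him
    refine (norm_bottomRow_term_le hb p hτ).trans ?_
    exact EisensteinSeries.summand_bound_of_mem_verticalStrip (z := ⟨τ, hτ⟩)
      (show (0 : ℝ) ≤ k - 1 / 2 by linarith) ![p.1.1, p.1.2] hB ⟨hre, him⟩

theorem summable_bottomRow {k : ℕ} (hk : 4 ≤ k) {f : {p : ℤ × ℤ // IsCoprime p.1 p.2} → ℂ → ℂ}
    (hb : ∀ p, ∀ τ : ℂ, 0 < τ.im → ‖f p τ‖ ≤ ‖(p.1.1 : ℂ) * τ + p.1.2‖ ^ (1 / 2 : ℝ))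
    {τ : ℂ} (hτ : 0 < τ.im) :
    Summable fun p : {p : ℤ × ℤ // IsCoprime p.1 p.2} =>
      ((p.1.1 : ℂ) * τ + p.1.2) ^ (-(k : ℤ)) * f p τ := by
  obtain ⟨u, hu, h⟩ := exists_bottomRow_bound hk hb |τ.re| hτ
  exact Summable.of_norm_bounded hu fun p => h p τ le_rfl le_rfl

theorem differentiableOn_bottomRowSum {k : ℕ} (hk : 4 ≤ k)
    {f : {p : ℤ × ℤ // IsCoprime p.1 p.2} → ℂ → ℂ}
    (hf : ∀ p, DifferentiableOn ℂ (f p) {τ | 0 < τ.im})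
    (hb : ∀ p, ∀ τ : ℂ, 0 < τ.im → ‖f p τ‖ ≤ ‖(p.1.1 : ℂ) * τ + p.1.2‖ ^ (1 / 2 : ℝ)) :
    DifferentiableOn ℂ (bottomRowSum k f) {τ | 0 < τ.im} := by
  intro τ hτ
  have hτ0 : 0 < τ.im := hτ
  obtain ⟨u, hu, h⟩ := exists_bottomRow_bound hk hb (|τ.re| + 1) (half_pos hτ0)
  let V : Set ℂ := {w | |w.re| < |τ.re| + 1} ∩ {w | τ.im / 2 < w.im}
  have hV : IsOpen V := (isOpen_lt (by fun_prop) (by fun_prop)).inter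
    (isOpen_lt (by fun_prop) (by fun_prop))
  have hVim : ∀ w ∈ V, 0 < w.im := fun w hw => (half_pos hτ0).trans hw.2
  have hd : DifferentiableOn ℂ (fun w => ∑' p : {p : ℤ × ℤ // IsCoprime p.1 p.2},
      ((p.1.1 : ℂ) * w + p.1.2) ^ (-(k : ℤ)) * f p w) V := by
    refine differentiableOn_tsum_of_summable_norm hu (fun p => ?_) hV
      fun p w hw => h p w hw.1.le hw.2.le
    refine DifferentiableOn.mul (DifferentiableOn.zpow (by fun_prop) (Or.inl fun w hw => ?_))
      ((hf p).mono hVim)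
    exact bottomRow_ne_zero p (hVim w hw)
  exact (((hd τ ⟨by simp, by simpa using hτ0⟩).differentiableAt
    (hV.mem_nhds ⟨by simp, by simpa using hτ0⟩)).const_mul _).differentiableWithinAt

theorem tsum_coprime_ite (a : ℂ) :
    ∑' p : {p : ℤ × ℤ // IsCoprime p.1 p.2}, (if p.1.1 = 0 then a else 0) = 2 * a := by
  let p₁ : {p : ℤ × ℤ // IsCoprime p.1 p.2} := ⟨(0, 1), isCoprime_one_right⟩
  let p₂ : {p : ℤ × ℤ // IsCoprime p.1 p.2} := ⟨(0, -1), isCoprime_one_right.neg_right⟩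
  rw [tsum_eq_sum (s := {p₁, p₂})]
  · rw [Finset.sum_pair (by simp [p₁, p₂])]
    simp [p₁, p₂, two_mul]
  · rintro ⟨⟨c, d⟩, h⟩ hp
    rw [if_neg]
    rintro rfl
    rw [isCoprime_zero_left, Int.isUnit_iff] at h
    rcases h with rfl | rfl <;> simp [p₁, p₂] at hp

theorem stripAtImInfty_eventually (B : ℝ) :
    ∀ᶠ τ : ℂ in stripAtImInfty, |τ.re| ≤ 1 ∧ B ≤ τ.im := by
  refine Eventually.and ?_ ?_
  · exact mem_inf_of_right (mem_principal_self _)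
  · exact (tendsto_comap.mono_left inf_le_left).eventually (eventually_ge_atTop B)

theorem tendsto_bottomRowSum {k : ℕ} (hk : 4 ≤ k) (hk2 : Even k)
    {f : {p : ℤ × ℤ // IsCoprime p.1 p.2} → ℂ → ℂ}
    (hb : ∀ p, ∀ τ : ℂ, 0 < τ.im → ‖f p τ‖ ≤ ‖(p.1.1 : ℂ) * τ + p.1.2‖ ^ (1 / 2 : ℝ))
    {a : ℂ} (ha : ∀ p, p.1.1 = 0 → ∀ τ, f p τ = a) :
    Tendsto (bottomRowSum k f) stripAtImInfty (𝓝 a) := by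
  have hk' : (4 : ℝ) ≤ k := by exact_mod_cast hk
  obtain ⟨u, hu, h⟩ := exists_bottomRow_bound hk hb 1 one_pos
  have hlim : Tendsto (fun τ => ∑' p : {p : ℤ × ℤ // IsCoprime p.1 p.2},
      ((p.1.1 : ℂ) * τ + p.1.2) ^ (-(k : ℤ)) * f p τ) stripAtImInfty
      (𝓝 (∑' p : {p : ℤ × ℤ // IsCoprime p.1 p.2}, if p.1.1 = 0 then a else 0)) := by
    refine tendsto_tsum_of_dominated_convergence hu (fun p => ?_) ?_
    · split_ifs with hc
      · refine tendsto_const_nhds.congr fun τ => ?_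
        have hp := p.2
        rw [hc, isCoprime_zero_left, Int.isUnit_iff] at hp
        rw [ha p hc, hc]
        rcases hp with hp | hp <;> simp [hp, hk2.neg_one_pow]
      · refine squeeze_zero_norm' (a := fun τ : ℂ => τ.im ^ (-((k : ℝ) - 1 / 2))) ?_ ?_
        · filter_upwards [stripAtImInfty_eventually 1] with τ hτ
          have him : 0 < τ.im := one_pos.trans_le hτ.2
          refine (norm_bottomRow_term_le hb p him).trans ?_
          refine Real.rpow_le_rpow_of_nonpos him ?_ (by linarith)
          refine le_trans ?_ (abs_im_le_norm _)
          have h1 : (1 : ℝ) ≤ |(p.1.1 : ℝ)| := by exact_mod_cast Int.one_le_abs hc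
          have : ((p.1.1 : ℂ) * τ + p.1.2).im = p.1.1 * τ.im := by simp
          rw [this, abs_mul, abs_of_pos him]
          exact le_mul_of_one_le_left him.le h1
        · exact (tendsto_rpow_neg_atTop (by linarith)).comp
            (tendsto_comap.mono_left inf_le_left)
    · filter_upwards [stripAtImInfty_eventually 1] with τ hτ p
      exact h p τ hτ.1 hτ.2
  rw [tsum_coprime_ite] at hlim
  have := hlim.const_mul (1 / 2)
  rwa [← mul_assoc, one_div_mul_cancel two_ne_zero, one_mul] at this

/-- The theta decomposition of the Jacobi–Eisenstein series of index one. -/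
theorem exists_EisJ_theta_decomposition {k : ℕ} (hk : 4 ≤ k) (hk2 : Even k) :
    ∃ h₀ h₁ : ℂ → ℂ, DifferentiableOn ℂ h₀ {τ | 0 < τ.im} ∧
      DifferentiableOn ℂ h₁ {τ | 0 < τ.im} ∧ Tendsto h₀ stripAtImInfty (𝓝 1) ∧
      Tendsto h₁ stripAtImInfty (𝓝 0) ∧
      ∀ τ z : ℂ, 0 < τ.im → EisJ k 1 τ z = h₀ τ * th0 τ z + h₁ τ * th1 τ z := by
  choose A B hA hB hAb hBb hAB h using exists_eisJSummand_decomposition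
  refine ⟨bottomRowSum k A, bottomRowSum k B, differentiableOn_bottomRowSum hk hA hAb,
    differentiableOn_bottomRowSum hk hB hBb,
    tendsto_bottomRowSum hk hk2 hAb fun p hp τ => (hAB p hp τ).1,
    tendsto_bottomRowSum hk hk2 hBb fun p hp τ => (hAB p hp τ).2, fun τ z hτ => ?_⟩
  rw [EisJ, bottomRowSum, bottomRowSum, mul_assoc, mul_assoc, ← mul_add, ← tsum_mul_right,
    ← tsum_mul_right, ← ((summable_bottomRow hk hAb hτ).mul_right _).tsum_add
      ((summable_bottomRow hk hBb hτ).mul_right _)]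
  congr 1
  refine tsum_congr fun p => ?_
  rw [h p k τ z hτ]
  ring

theorem tendsto_jacobiTheta : Tendsto jacobiTheta (comap Complex.im atTop) (𝓝 1) := by
  have h : Tendsto (fun τ : ℂ => Real.exp (-Real.pi * τ.im)) (comap Complex.im atTop) (𝓝 0) :=
    Real.tendsto_exp_atBot.comp
      (tendsto_comap.const_mul_atTop_of_neg (neg_lt_zero.mpr Real.pi_pos))
  have := (isBigO_at_im_infty_jacobiTheta_sub_one.trans_tendsto h).add_const 1
  simpa using this

theorem th0_zero_eq (τ : ℂ) : th0 τ 0 = jacobiTheta (2 * τ) := by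
  rw [th0, mul_zero, jacobiTheta_eq_jacobiTheta₂]

theorem tendsto_th0_zero : Tendsto (fun τ => th0 τ 0) stripAtImInfty (𝓝 1) := by
  simp_rw [th0_zero_eq]
  refine tendsto_jacobiTheta.comp (tendsto_comap_iff.mpr ?_)
  have : Tendsto (fun τ : ℂ => 2 * τ.im) stripAtImInfty atTop :=
    (tendsto_comap.mono_left inf_le_left).const_mul_atTop two_pos
  exact this.congr fun τ => by simp

theorem tendsto_th1_zero : Tendsto (fun τ => th1 τ 0) stripAtImInfty (𝓝 0) := by
  have h : Tendsto (fun τ : ℂ => jacobiTheta (τ / 2)) stripAtImInfty (𝓝 1) := by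
    refine tendsto_jacobiTheta.comp (tendsto_comap_iff.mpr ?_)
    have : Tendsto (fun τ : ℂ => τ.im / 2) stripAtImInfty atTop :=
      (tendsto_comap.mono_left inf_le_left).atTop_div_const two_pos
    exact this.congr fun τ => by simp [Complex.div_ofNat_im]
  have := h.sub tendsto_th0_zero
  rw [sub_self] at this
  refine this.congr' ?_
  filter_upwards [stripAtImInfty_eventually 1] with τ hτ
  rw [jacobiTheta_eq_jacobiTheta₂, jacobiTheta₂_half_eq (one_pos.trans_le hτ.2),
    add_sub_cancel_left]

theorem eq_zero_of_mul_eq_zero_of_tendsto_one {f g : ℂ → ℂ}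
    (hf : DifferentiableOn ℂ f {τ | 0 < τ.im}) (hg : Tendsto g stripAtImInfty (𝓝 1))
    (hfg : ∀ τ : ℂ, 0 < τ.im → f τ * g τ = 0) {τ : ℂ} (hτ : 0 < τ.im) : f τ = 0 := by
  have h1 : ∀ᶠ τ in stripAtImInfty, g τ ≠ 0 := hg.eventually_ne one_ne_zero
  rw [stripAtImInfty, eventually_inf_principal, eventually_comap] at h1
  obtain ⟨M, hM⟩ := eventually_atTop.mp h1
  have hopen : IsOpen {τ : ℂ | 0 < τ.im} := isOpen_lt continuous_const Complex.continuous_im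
  have hmem : (((max M 0 + 1 : ℝ) : ℂ) * I).im = max M 0 + 1 := by simp
  refine (hf.analyticOnNhd hopen).eqOn_zero_of_preconnected_of_eventuallyEq_zero
    (convex_halfSpace_im_gt 0).isPreconnected
    (z₀ := ((max M 0 + 1 : ℝ) : ℂ) * I) ?_ ?_ hτ
  · rw [Set.mem_ofPred_eq, hmem]
    positivity
  · have hV : IsOpen ({w : ℂ | |w.re| < 1} ∩ {w : ℂ | max M 0 < w.im}) :=
      (isOpen_lt (by fun_prop) (by fun_prop)).inter (isOpen_lt (by fun_prop) (by fun_prop))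
    filter_upwards [hV.mem_nhds ⟨by simp, by
      rw [Set.mem_ofPred_eq, hmem]
      exact lt_add_one _⟩] with w hw
    exact (mul_eq_zero.mp (hfg w ((le_max_right M 0).trans_lt hw.2))).resolve_right
      (hM w.im ((le_max_left M 0).trans hw.2.le) w rfl (show |w.re| < 1 from hw.1).le)

theorem th0_zero_neg_one_div {τ : ℂ} (hτ : 0 < τ.im) :
    th0 (-1 / τ) 0 = sqrtFactor τ * (th0 τ 0 + th1 τ 0) := by
  simpa [e2_zero] using th0_neg_one_div hτ 0

theorem th1_zero_neg_one_div {τ : ℂ} (hτ : 0 < τ.im) :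
    th1 (-1 / τ) 0 = sqrtFactor τ * (th0 τ 0 - th1 τ 0) := by
  simpa [e2_zero] using th1_neg_one_div hτ 0

/-- There is no nonzero Jacobi cusp form of index one and weight `k < 10`, in terms of the
coefficients of the theta decomposition. -/
theorem theta_coefficients_eq_zero {k : ℕ} (hk : k < 10) {D : ℂ → ℂ → ℂ} {d₀ d₁ : ℂ → ℂ}
    (hd₀ : DifferentiableOn ℂ d₀ {τ | 0 < τ.im}) (hd₁ : DifferentiableOn ℂ d₁ {τ | 0 < τ.im})
    (hl₀ : Tendsto d₀ stripAtImInfty (𝓝 0)) (hl₁ : Tendsto d₁ stripAtImInfty (𝓝 0))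
    (hD : ∀ τ z : ℂ, 0 < τ.im → D τ z = d₀ τ * th0 τ z + d₁ τ * th1 τ z)
    (hT : ∀ τ z : ℂ, 0 < τ.im → D (τ + 1) z = D τ z)
    (hS : ∀ τ z : ℂ, 0 < τ.im → D (-1 / τ) (z / τ) = τ ^ k * e2 (z ^ 2 / τ) * D τ z)
    {τ : ℂ} (hτ : 0 < τ.im) : d₀ τ = 0 ∧ d₁ τ = 0 := by
  have hx : DifferentiableOn ℂ (fun τ => th0 τ 0) {τ | 0 < τ.im} := fun τ hτ =>
    (differentiableAt_th0 hτ 0).differentiableWithinAt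
  have hy : DifferentiableOn ℂ (fun τ => th1 τ 0) {τ | 0 < τ.im} := fun τ hτ =>
    (differentiableAt_th1 hτ 0).differentiableWithinAt
  have him1 : ∀ {τ : ℂ}, 0 < τ.im → 0 < (τ + 1).im := fun h => by simpa using h
  have hne : ∀ {τ : ℂ}, 0 < τ.im → τ ≠ 0 := by
    rintro _ h rfl
    simp at h
  have hF : ∀ τ : ℂ, 0 < τ.im → d₀ τ * th0 τ 0 + d₁ τ * th1 τ 0 = 0 := by
    refine eq_zero_of_cuspidal_of_weight_lt_twelve (k := k) (by omega)
      ((hd₀.mul hx).add (hd₁.mul hy)) (fun τ hτ => ?_) (fun τ hτ => ?_) ?_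
    · rw [← hD _ _ hτ, ← hD _ _ (him1 hτ), hT _ _ hτ]
    · have := hS τ 0 hτ
      rw [zero_div, zero_pow two_ne_zero, zero_div, e2_zero, mul_one] at this
      rw [← hD _ _ hτ, ← hD _ _ (im_neg_one_div_pos hτ), this, zpow_natCast]
    · simpa using (hl₀.mul tendsto_th0_zero).add (hl₁.mul tendsto_th1_zero)
  have hA : ∀ τ : ℂ, 0 < τ.im → D τ (1 / 2) = d₀ τ * th0 τ 0 - d₁ τ * th1 τ 0 := by
    intro τ hτ
    have h0 := th0_add_half τ 0
    have h1 := th1_add_half τ 0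
    rw [zero_add] at h0 h1
    rw [hD _ _ hτ, h0, h1]
    ring
  have hAS : ∀ τ : ℂ, 0 < τ.im →
      D (-1 / τ) (1 / 2) = τ ^ k * (d₀ τ * th1 τ 0 + d₁ τ * th0 τ 0) := by
    intro τ hτ
    have h := hS τ (τ / 2) hτ
    have hτ0 := hne hτ
    rw [div_right_comm, div_self hτ0, show (τ / 2) ^ 2 / τ = τ / 4 by field_simp; norm_num,
      hD _ _ hτ] at h
    rw [h, ← th0_half_period, ← th1_half_period]
    ring
  have hG : ∀ τ : ℂ, 0 < τ.im →
      (d₀ τ * th0 τ 0 - d₁ τ * th1 τ 0) * (th0 τ 0 ^ 4 - th1 τ 0 ^ 4) = 0 := by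
    refine eq_zero_of_cuspidal_of_weight_lt_twelve (k := (k + 2 : ℕ)) (by omega)
      (((hd₀.mul hx).sub (hd₁.mul hy)).mul ((hx.pow 4).sub (hy.pow 4))) (fun τ hτ => ?_)
      (fun τ hτ => ?_) ?_
    · rw [← hA _ hτ, ← hA _ (him1 hτ), hT _ _ hτ, th0_add_one, th1_add_one, mul_pow, I_pow_four,
        one_mul]
    · have hr : sqrtFactor τ ^ 4 = -τ ^ 2 / 4 := by
        rw [show 4 = 2 * 2 from rfl, pow_mul, sqrtFactor_sq]
        linear_combination τ ^ 2 / 4 * I_sq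
      rw [← hA _ (im_neg_one_div_pos hτ), hAS τ hτ, th0_zero_neg_one_div hτ,
        th1_zero_neg_one_div hτ, mul_pow, mul_pow, hr, zpow_natCast, pow_add]
      have := hF τ hτ
      generalize th0 τ 0 = x at *
      generalize th1 τ 0 = y at *
      linear_combination (-τ ^ k * τ ^ 2 * (x ^ 4 - y ^ 4) -
        2 * τ ^ k * τ ^ 2 * y ^ 2 * (x ^ 2 + y ^ 2)) * this
    · simpa using ((hl₀.mul tendsto_th0_zero).sub (hl₁.mul tendsto_th1_zero)).mul
        ((tendsto_th0_zero.pow 4).sub (tendsto_th1_zero.pow 4))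
  have hA0 : ∀ τ : ℂ, 0 < τ.im → d₀ τ * th0 τ 0 - d₁ τ * th1 τ 0 = 0 := fun τ hτ =>
    eq_zero_of_mul_eq_zero_of_tendsto_one ((hd₀.mul hx).sub (hd₁.mul hy))
      (by simpa using (tendsto_th0_zero.pow 4).sub (tendsto_th1_zero.pow 4)) hG hτ
  have h0 : ∀ τ : ℂ, 0 < τ.im → d₀ τ = 0 := fun τ hτ =>
    eq_zero_of_mul_eq_zero_of_tendsto_one hd₀ tendsto_th0_zero (fun τ hτ => by
      linear_combination (hF τ hτ + hA0 τ hτ) / 2) hτ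
  refine ⟨h0 τ hτ, eq_zero_of_mul_eq_zero_of_tendsto_one hd₁ tendsto_th0_zero (fun τ hτ => ?_) hτ⟩
  have h := hAS τ hτ
  rw [hA _ (im_neg_one_div_pos hτ), hA0 _ (im_neg_one_div_pos hτ), h0 τ hτ, zero_mul, zero_add,
    eq_comm, mul_eq_zero] at h
  exact h.resolve_left (pow_ne_zero _ (hne hτ))

/-- The theta decomposition of a Jacobi–Eisenstein series of index one is determined by its
invariance and its constant term when the weight is less than `10`. -/
theorem EisJ_eq_of_theta_decomposition {k : ℕ} (hk : 4 ≤ k) (hk' : k < 10) (hk2 : Even k)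
    {P : ℂ → ℂ → ℂ} {p₀ p₁ : ℂ → ℂ}
    (hp₀ : DifferentiableOn ℂ p₀ {τ | 0 < τ.im}) (hp₁ : DifferentiableOn ℂ p₁ {τ | 0 < τ.im})
    (hl₀ : Tendsto p₀ stripAtImInfty (𝓝 1)) (hl₁ : Tendsto p₁ stripAtImInfty (𝓝 0))
    (hP : ∀ τ z : ℂ, 0 < τ.im → P τ z = p₀ τ * th0 τ z + p₁ τ * th1 τ z)
    (hT : ∀ τ z : ℂ, 0 < τ.im → P (τ + 1) z = P τ z)
    (hS : ∀ τ z : ℂ, 0 < τ.im → P (-1 / τ) (z / τ) = τ ^ k * e2 (z ^ 2 / τ) * P τ z)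
    {τ : ℂ} (hτ : 0 < τ.im) (z : ℂ) : EisJ k 1 τ z = P τ z := by
  obtain ⟨h₀, h₁, hd₀, hd₁, ht₀, ht₁, h⟩ := exists_EisJ_theta_decomposition hk hk2
  obtain ⟨e₀, e₁⟩ := theta_coefficients_eq_zero hk' (D := fun τ z => EisJ k 1 τ z - P τ z)
    (d₀ := fun τ => h₀ τ - p₀ τ) (d₁ := fun τ => h₁ τ - p₁ τ)
    (hd₀.sub hp₀) (hd₁.sub hp₁) (by simpa using ht₀.sub hl₀) (by simpa using ht₁.sub hl₁)
    (fun τ z hτ => by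
      rw [h τ z hτ, hP τ z hτ]
      ring)
    (fun τ z hτ => by simp only [EisJ_add_one k hτ, hT τ z hτ])
    (fun τ z hτ => by simp only [EisJ_neg_one_div k hτ, hS τ z hτ, mul_sub]) hτ
  rw [sub_eq_zero] at e₀ e₁
  rw [h τ z hτ, hP τ z hτ, e₀, e₁]

theorem EisJ_four_one {τ : ℂ} (hτ : 0 < τ.im) (z : ℂ) :
    EisJ 4 1 τ z = (th0 τ 0 ^ 7 + 7 * th0 τ 0 ^ 3 * th1 τ 0 ^ 4) * th0 τ z +
      (th1 τ 0 ^ 7 + 7 * th0 τ 0 ^ 4 * th1 τ 0 ^ 3) * th1 τ z := by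
  have hx : DifferentiableOn ℂ (fun τ => th0 τ 0) {τ | 0 < τ.im} := fun τ hτ =>
    (differentiableAt_th0 hτ 0).differentiableWithinAt
  have hy : DifferentiableOn ℂ (fun τ => th1 τ 0) {τ | 0 < τ.im} := fun τ hτ =>
    (differentiableAt_th1 hτ 0).differentiableWithinAt
  have hlx := tendsto_th0_zero
  have hly := tendsto_th1_zero
  refine EisJ_eq_of_theta_decomposition le_rfl (by norm_num) (by decide)
    (P := fun τ z => (th0 τ 0 ^ 7 + 7 * th0 τ 0 ^ 3 * th1 τ 0 ^ 4) * th0 τ z +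
      (th1 τ 0 ^ 7 + 7 * th0 τ 0 ^ 4 * th1 τ 0 ^ 3) * th1 τ z)
    (p₀ := fun τ => th0 τ 0 ^ 7 + 7 * th0 τ 0 ^ 3 * th1 τ 0 ^ 4)
    (p₁ := fun τ => th1 τ 0 ^ 7 + 7 * th0 τ 0 ^ 4 * th1 τ 0 ^ 3)
    ((hx.pow 7).add (((hx.pow 3).const_mul 7).mul (hy.pow 4)))
    ((hy.pow 7).add (((hx.pow 4).const_mul 7).mul (hy.pow 3)))
    (by simpa using (hlx.pow 7).add (((hlx.pow 3).const_mul 7).mul (hly.pow 4)))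
    (by simpa using (hly.pow 7).add (((hlx.pow 4).const_mul 7).mul (hly.pow 3)))
    (fun τ z _ => rfl) (fun τ z _ => ?_) (fun τ z hτ => ?_) hτ z
  · simp only [th0_add_one, th1_add_one]
    ring_nf
    simp only [I_pow_four, show I ^ 8 = 1 by rw [show 8 = 4 * 2 from rfl, pow_mul, I_pow_four, one_pow]]
    ring
  · have hr : sqrtFactor τ ^ 8 = τ ^ 4 / 16 := by
      rw [show 8 = 2 * 4 from rfl, pow_mul, sqrtFactor_sq]
      linear_combination τ ^ 4 / 16 * I_pow_four
    simp only [th0_zero_neg_one_div hτ, th1_zero_neg_one_div hτ, th0_neg_one_div hτ z,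
      th1_neg_one_div hτ z]
    generalize th0 τ 0 = x
    generalize th1 τ 0 = y
    generalize e2 (z ^ 2 / τ) = e
    generalize th0 τ z = u
    generalize th1 τ z = v
    linear_combination 16 * e * ((x ^ 7 + 7 * x ^ 3 * y ^ 4) * u +
      (y ^ 7 + 7 * x ^ 4 * y ^ 3) * v) * hr

theorem EisJ_six_one {τ : ℂ} (hτ : 0 < τ.im) (z : ℂ) :
    EisJ 6 1 τ z =
      (th0 τ 0 ^ 11 - 22 * th0 τ 0 ^ 7 * th1 τ 0 ^ 4 - 11 * th0 τ 0 ^ 3 * th1 τ 0 ^ 8) * th0 τ z +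
      (th1 τ 0 ^ 11 - 22 * th0 τ 0 ^ 4 * th1 τ 0 ^ 7 - 11 * th0 τ 0 ^ 8 * th1 τ 0 ^ 3) *
        th1 τ z := by
  have hx : DifferentiableOn ℂ (fun τ => th0 τ 0) {τ | 0 < τ.im} := fun τ hτ =>
    (differentiableAt_th0 hτ 0).differentiableWithinAt
  have hy : DifferentiableOn ℂ (fun τ => th1 τ 0) {τ | 0 < τ.im} := fun τ hτ =>
    (differentiableAt_th1 hτ 0).differentiableWithinAt
  have hlx := tendsto_th0_zero
  have hly := tendsto_th1_zero
  refine EisJ_eq_of_theta_decomposition (by norm_num) (by norm_num) (by decide)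
    (P := fun τ z =>
      (th0 τ 0 ^ 11 - 22 * th0 τ 0 ^ 7 * th1 τ 0 ^ 4 - 11 * th0 τ 0 ^ 3 * th1 τ 0 ^ 8) * th0 τ z +
      (th1 τ 0 ^ 11 - 22 * th0 τ 0 ^ 4 * th1 τ 0 ^ 7 - 11 * th0 τ 0 ^ 8 * th1 τ 0 ^ 3) * th1 τ z)
    (p₀ := fun τ =>
      th0 τ 0 ^ 11 - 22 * th0 τ 0 ^ 7 * th1 τ 0 ^ 4 - 11 * th0 τ 0 ^ 3 * th1 τ 0 ^ 8)
    (p₁ := fun τ =>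
      th1 τ 0 ^ 11 - 22 * th0 τ 0 ^ 4 * th1 τ 0 ^ 7 - 11 * th0 τ 0 ^ 8 * th1 τ 0 ^ 3)
    (((hx.pow 11).sub (((hx.pow 7).const_mul 22).mul (hy.pow 4))).sub
      (((hx.pow 3).const_mul 11).mul (hy.pow 8)))
    (((hy.pow 11).sub (((hx.pow 4).const_mul 22).mul (hy.pow 7))).sub
      (((hx.pow 8).const_mul 11).mul (hy.pow 3)))
    (by
      simpa using Tendsto.sub ((hlx.pow 11).sub (((hlx.pow 7).const_mul 22).mul (hly.pow 4)))
        (((hlx.pow 3).const_mul 11).mul (hly.pow 8)))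
    (by
      simpa using Tendsto.sub ((hly.pow 11).sub (((hlx.pow 4).const_mul 22).mul (hly.pow 7)))
        (((hlx.pow 8).const_mul 11).mul (hly.pow 3)))
    (fun τ z _ => rfl) (fun τ z _ => ?_) (fun τ z hτ => ?_) hτ z
  · simp only [th0_add_one, th1_add_one]
    ring_nf
    simp only [I_pow_four, show I ^ 8 = 1 by rw [show 8 = 4 * 2 from rfl, pow_mul, I_pow_four, one_pow],
      show I ^ 12 = 1 by rw [show 12 = 4 * 3 from rfl, pow_mul, I_pow_four, one_pow]]
    ring
  · have hr : sqrtFactor τ ^ 12 = -τ ^ 6 / 64 := by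
      rw [show 12 = 2 * 6 from rfl, pow_mul, sqrtFactor_sq]
      have : I ^ 6 = -1 := by rw [show 6 = 4 + 2 from rfl, pow_add, I_pow_four, one_mul, I_sq]
      linear_combination τ ^ 6 / 64 * this
    simp only [th0_zero_neg_one_div hτ, th1_zero_neg_one_div hτ, th0_neg_one_div hτ z,
      th1_neg_one_div hτ z]
    generalize th0 τ 0 = x
    generalize th1 τ 0 = y
    generalize e2 (z ^ 2 / τ) = e
    generalize th0 τ z = u
    generalize th1 τ z = v
    linear_combination -64 * e * ((x ^ 11 - 22 * x ^ 7 * y ^ 4 - 11 * x ^ 3 * y ^ 8) * u +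
      (y ^ 11 - 22 * x ^ 4 * y ^ 7 - 11 * x ^ 8 * y ^ 3) * v) * hr

end

theorem norm_e2_lt_one {τ : ℂ} (hτ : 0 < τ.im) : ‖e2 τ‖ < 1 := by
  rw [e2, Complex.norm_exp, Real.exp_lt_one_iff]
  have : (2 * (Real.pi : ℂ) * I * τ).re = -(2 * Real.pi * τ.im) := by simp
  rw [this]
  have := Real.pi_pos
  rw [neg_lt_zero]
  positivity

theorem e2_intCast_mul_of_nonneg {n : ℤ} (hn : 0 ≤ n) (τ : ℂ) : e2 (n * τ) = e2 τ ^ n.toNat := by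
  rw [← e2_natCast_mul]
  congr 2
  exact_mod_cast (Int.toNat_of_nonneg hn).symm

theorem evalsTo_intSquareSeries {τ : ℂ} (hτ : 0 < τ.im) :
    EvalsTo intSquareSeries (e2 τ) (th0 τ 0) := by
  obtain ⟨x, hx, hx'⟩ := exists_evalsTo_squareSeries (norm_e2_lt_one hτ)
  convert hx
  refine (hasSum_th0 hτ 0).unique (hx'.congr_fun fun n => ?_)
  rw [← e2_intCast_mul_of_nonneg (sq_nonneg n)]
  push_cast
  ring_nf

theorem exists_evalsTo_pronicSeries_th1 {τ : ℂ} (hτ : 0 < τ.im) :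
    ∃ y, EvalsTo pronicSeries (e2 τ) y ∧ th1 τ 0 = e2 (τ / 4) * (2 * y) := by
  obtain ⟨y, hy, hy'⟩ := exists_evalsTo_pronicSeries (norm_e2_lt_one hτ)
  refine ⟨y, hy, (hasSum_th1 hτ 0).unique ((hy'.mul_left _).congr_fun fun n => ?_)⟩
  rw [← e2_intCast_mul_of_nonneg (by nlinarith [mul_self_nonneg (2 * n + 1)]), ← e2_add]
  push_cast
  ring_nf

theorem e2_div_four_pow_four (τ : ℂ) : e2 (τ / 4) ^ 4 = e2 τ := by
  rw [← e2_natCast_mul]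
  congr 1
  push_cast
  ring

theorem hasSum_th1_shift {τ : ℂ} (hτ : 0 < τ.im) (z : ℂ) :
    HasSum (fun l : ℤ => e2 (((l : ℂ) ^ 2 + l + 1) * τ + (2 * l + 1) * z))
      (e2 (τ / 4) ^ 3 * th1 τ z) := by
  refine ((hasSum_th1 hτ z).mul_left (e2 (τ / 4) ^ 3)).congr_fun fun l => ?_
  rw [← e2_natCast_mul, ← e2_add]
  push_cast
  ring_nf

/-- The power series in `q` attached to the even theta coefficient of `E_{4,1}`. -/
def evenPartFour : PowerSeries ℤ := intSquareSeries ^ 7 + 7 * intSquareSeries ^ 3 * pronicFourth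

/-- The power series in `q` attached to the odd theta coefficient of `E_{4,1}`. -/
def oddPartFour : PowerSeries ℤ := 8 * pronicSeries ^ 3 * (pronicFourth + 7 * intSquareSeries ^ 4)

/-- The power series in `q` attached to the even theta coefficient of `E_{6,1}`. -/
def evenPartSix : PowerSeries ℤ :=
  intSquareSeries ^ 11 - 22 * intSquareSeries ^ 7 * pronicFourth -
    11 * intSquareSeries ^ 3 * pronicFourth ^ 2

/-- The power series in `q` attached to the odd theta coefficient of `E_{6,1}`. -/
def oddPartSix : PowerSeries ℤ :=
  8 * pronicSeries ^ 3 * (pronicFourth ^ 2 - 22 * intSquareSeries ^ 4 * pronicFourth -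
    11 * intSquareSeries ^ 8)

theorem evalsTo_pronicFourth {q y : ℂ} (hy : EvalsTo pronicSeries q y) :
    EvalsTo pronicFourth q (16 * q * y ^ 4) :=
  ((EvalsTo.ofNat 16 q).mul (EvalsTo.X q)).mul (hy.pow 4)

theorem hasSum_EisJ_four {τ : ℂ} (hτ : 0 < τ.im) (z : ℂ) :
    HasSum (fun p : ℕ × ℤ =>
      (jacobiCoeff evenPartFour oddPartFour p : ℂ) * e2 ((p.1 : ℂ) * τ + (p.2 : ℂ) * z))
      (EisJ 4 1 τ z) := by
  have hx := evalsTo_intSquareSeries hτ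
  obtain ⟨y, hy, hy1⟩ := exists_evalsTo_pronicSeries_th1 hτ
  have hV := evalsTo_pronicFourth hy
  have h₀ : EvalsTo evenPartFour (e2 τ) _ :=
    (hx.pow 7).add (((EvalsTo.ofNat 7 _).mul (hx.pow 3)).mul hV)
  have h₁ : EvalsTo oddPartFour (e2 τ) _ :=
    ((EvalsTo.ofNat 8 _).mul (hy.pow 3)).mul (hV.add ((EvalsTo.ofNat 7 _).mul (hx.pow 4)))
  convert hasSum_jacobiCoeff h₀ h₁ (hasSum_th0 hτ z) (hasSum_th1_shift hτ z) using 1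
  rw [EisJ_four_one hτ, hy1, ← e2_div_four_pow_four τ]
  ring

theorem hasSum_EisJ_six {τ : ℂ} (hτ : 0 < τ.im) (z : ℂ) :
    HasSum (fun p : ℕ × ℤ =>
      (jacobiCoeff evenPartSix oddPartSix p : ℂ) * e2 ((p.1 : ℂ) * τ + (p.2 : ℂ) * z))
      (EisJ 6 1 τ z) := by
  have hx := evalsTo_intSquareSeries hτ
  obtain ⟨y, hy, hy1⟩ := exists_evalsTo_pronicSeries_th1 hτ
  have hV := evalsTo_pronicFourth hy
  have h₀ : EvalsTo evenPartSix (e2 τ) _ :=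
    ((hx.pow 11).sub (((EvalsTo.ofNat 22 _).mul (hx.pow 7)).mul hV)).sub
      (((EvalsTo.ofNat 11 _).mul (hx.pow 3)).mul (hV.pow 2))
  have h₁ : EvalsTo oddPartSix (e2 τ) _ :=
    ((EvalsTo.ofNat 8 _).mul (hy.pow 3)).mul
      (((hV.pow 2).sub (((EvalsTo.ofNat 22 _).mul (hx.pow 4)).mul hV)).sub
        ((EvalsTo.ofNat 11 _).mul (hx.pow 8)))
  convert hasSum_jacobiCoeff h₀ h₁ (hasSum_th0 hτ z) (hasSum_th1_shift hτ z) using 1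
  rw [EisJ_six_one hτ, hy1, ← e2_div_four_pow_four τ]
  ring

/-- the Fourier coefficients of `E_{4,1}` and `E_{6,1}` are integers and are
congruent modulo `24`. -/
theorem E41_E61_congruent_mod_24 :
    ∃ a b : ℕ → ℤ → ℤ,
      (∀ τ z : ℂ, 0 < τ.im →
        HasSum (fun p : ℕ × ℤ => (a p.1 p.2 : ℂ) * e2 ((p.1 : ℂ) * τ + (p.2 : ℂ) * z))
          (EisJ 4 1 τ z)) ∧
      (∀ τ z : ℂ, 0 < τ.im →
        HasSum (fun p : ℕ × ℤ => (b p.1 p.2 : ℂ) * e2 ((p.1 : ℂ) * τ + (p.2 : ℂ) * z))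
          (EisJ 6 1 τ z)) ∧
      (∀ n : ℕ, ∀ l : ℤ, a n l ≡ b n l [ZMOD 24]) := by
  have hC : PowerSeries.C (24 : ℤ) = 24 := map_ofNat _ 24
  exact ⟨fun n l => jacobiCoeff evenPartFour oddPartFour (n, l),
    fun n l => jacobiCoeff evenPartSix oddPartSix (n, l),
    fun τ z hτ => hasSum_EisJ_four hτ z, fun τ z hτ => hasSum_EisJ_six hτ z,
    fun n l => jacobiCoeff_modEq (hC ▸ dvd_sub_even_part) (hC ▸ dvd_sub_odd_part) (n, l)⟩

end JacobiPaper
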